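/- arXiv:2602.03738 — 10 statements merged into one kernel-verified Lean document; each statement's English description precedes it below -/
import Mathlib

section
/- Suppose there is a constant c_φ > 0 with φ(r) > c_φ for all r ∈ [−2,2], and suppose the weight dynamics are admissible with the additional property that there is a constant c_f > 0 such that f⁺(v)_{ij} > c_f for every matrix v with entries in [0,1] satisfying v_{ij} = 0 (i ≠ j). Then the population reaches consensus: D(t) → 0 as t → ∞. -/
open Filter Topology MeasureTheory

def cube (N : ℕ) : Set (Fin N → Fin N → ℝ) :=
  {v | ∀ i j, v i j ∈ Set.Icc (0:ℝ) 1}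

/-- Barrier lemma for a finite family of differentiable functions. -/
theorem barrier_aux {ι : Type*} [Finite ι] (u u' : ι → ℝ → ℝ) (B B' : ℝ → ℝ) (T : ℝ)
    (hu : ∀ i, ∀ t, T ≤ t → HasDerivAt (u i) (u' i t) t)
    (hB : ∀ t, T ≤ t → HasDerivAt B (B' t) t)
    (h0 : ∀ i, u i T ≤ B T)
    (h : ∀ i, ∀ t, T ≤ t → u i t = B t → (∀ j, u j t ≤ B t) → u' i t < B' t) :
    ∀ t, T ≤ t → ∀ i, u i t ≤ B t := by
  intro b hb
  have hsub : Set.Icc T b ⊆ {t | ∀ i, u i t ≤ B t} := by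
    apply IsClosed.Icc_subset_of_forall_exists_gt
    · have : {t | ∀ i, u i t ≤ B t} ∩ Set.Icc T b
          = Set.Icc T b ∩ ⋂ i, ({t | t ∈ Set.Icc T b ∧ u i t ≤ B t}) := by
        ext t
        simp only [Set.mem_inter_iff, Set.mem_ofPred_eq, Set.mem_iInter]
        constructor
        · rintro ⟨h1, h2⟩
          exact ⟨h2, fun i => ⟨h2, h1 i⟩⟩
        · rintro ⟨h1, h2⟩
          exact ⟨fun i => (h2 i).2, h1⟩
      rw [this]
      refine isClosed_Icc.inter (isClosed_iInter fun i => ?_)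
      refine isClosed_Icc.isClosed_le ?_ ?_
      · exact fun t ht => (hu i t ht.1).continuousAt.continuousWithinAt
      · exact fun t ht => (hB t ht.1).continuousAt.continuousWithinAt
    · exact h0
    · rintro t ⟨ht, htT⟩ y hy
      have key : ∀ i, ∀ᶠ s in 𝓝[>] t, u i s ≤ B s := by
        intro i
        have hc := (hu i t htT.1).sub (hB t htT.1)
        rcases lt_or_eq_of_le (ht i) with hlt | heq
        · have := hc.continuousAt.eventually_lt (continuousAt_const (y := (0:ℝ)))
            (by simp; exact hlt)
          refine (this.filter_mono nhdsWithin_le_nhds).mono fun s hs => ?_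
          simp at hs
          exact hs.le
        · have hneg : u' i t - B' t < 0 := by linarith [h i t htT.1 heq ht]
          have h2 := (hasDerivAt_iff_tendsto_slope.1 hc)
          have h3 := (h2.mono_left (nhdsGT_le_nhdsNE t)).eventually_lt_const hneg
          filter_upwards [h3, self_mem_nhdsWithin] with s hs hst
          have hst' : 0 < s - t := sub_pos.2 hst
          rw [slope_def_field, div_lt_iff₀ hst'] at hs
          simp at hs
          linarith
      have hall := eventually_all.2 key
      have hI : Set.Ioc t y ∈ 𝓝[>] t := Ioc_mem_nhdsGT hy
      obtain ⟨s, hs1, hs2⟩ := (hall.and (eventually_mem_set.2 hI)).exists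
      exact ⟨s, hs1, hs2⟩
  exact hsub ⟨hb, le_rfl⟩

/-- Bound on the velocity of an extreme agent. -/
theorem vel_bound {N : ℕ} (w : Fin N → ℝ) (p d : Fin N → ℝ) (i j : Fin N)
    (hw : ∀ k, w k ∈ Set.Icc (0:ℝ) 1) (hwi : w i = 1) (hp : ∀ k, 0 ≤ p k)
    (hd : ∀ k, d k ≤ 0) (δ c : ℝ) (hδ : 0 ≤ δ) (hc : 0 ≤ c) (hδw : δ ≤ w j) (hcp : c ≤ p j) :
    (1 / ∑ k, w k) * ∑ k, w k * p k * d k ≤ (1 / N) * (δ * c) * d j := by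
  have hk1 : 1 ≤ ∑ k, w k := by
    rw [← hwi]
    exact Finset.single_le_sum (fun k _ => (hw k).1) (Finset.mem_univ i)
  have hkN : ∑ k, w k ≤ N := by
    calc ∑ k, w k ≤ ∑ k : Fin N, (1:ℝ) := Finset.sum_le_sum fun k _ => (hw k).2
      _ = N := by simp
  have hs : ∑ k, w k * p k * d k ≤ w j * p j * d j := by
    have := Finset.single_le_sum (f := fun k => - (w k * p k * d k))
      (fun k _ => by
        have := mul_nonneg (hw k).1 (hp k)
        have := hd k
        show 0 ≤ - (w k * p k * d k)
        nlinarith) (Finset.mem_univ j)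
    rw [Finset.sum_neg_distrib] at this
    linarith
  have h2 : δ * c ≤ w j * p j := mul_le_mul hδw hcp hc (hw j).1
  have h3 : w j * p j * d j ≤ δ * c * d j := mul_le_mul_of_nonpos_right h2 (hd j)
  have h4 : δ * c * d j ≤ 0 := mul_nonpos_of_nonneg_of_nonpos (mul_nonneg hδ hc) (hd j)
  have hinv : (1:ℝ) / N ≤ 1 / ∑ k, w k := one_div_le_one_div_of_le (by linarith) hkN
  have hpos : (0:ℝ) ≤ 1 / ∑ k, w k := by positivity
  calc (1 / ∑ k, w k) * ∑ k, w k * p k * d k ≤ (1 / ∑ k, w k) * (δ * c * d j) :=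
        mul_le_mul_of_nonneg_left (hs.trans h3) hpos
    _ ≤ (1 / N) * (δ * c * d j) := mul_le_mul_of_nonpos_right hinv h4
    _ = _ := by ring

theorem stmt0
    (N : ℕ) (hN : 1 ≤ N)
    (x : ℝ → Fin N → ℝ) (w : ℝ → Fin N → Fin N → ℝ)
    (φ : ℝ → ℝ)
    (hφ_lip : ∃ L : NNReal, LipschitzWith L φ)
    (hφ_range : ∀ r : ℝ, φ r ∈ Set.Icc (0:ℝ) 1)
    (hφ_even : ∀ r : ℝ, φ (-r) = φ r)
    (hw01 : ∀ t : ℝ, 0 ≤ t → ∀ i j, w t i j ∈ Set.Icc (0:ℝ) 1)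
    (hwdiag : ∀ t : ℝ, 0 ≤ t → ∀ i, w t i i = 1)
    (hx0 : ∀ i, x 0 i ∈ Set.Icc (-1:ℝ) 1)
    (hx : ∀ i, ∀ t : ℝ, 0 ≤ t →
      HasDerivAt (fun s => x s i)
        ((1 / ∑ j, w t i j) * ∑ j, w t i j * φ (x t j - x t i) * (x t j - x t i)) t)
    (fp fm : (Fin N → Fin N → ℝ) → (Fin N → Fin N → ℝ))
    (hfp_lip : ∃ L : NNReal, LipschitzOnWith L fp (cube N))
    (hfm_lip : ∃ L : NNReal, LipschitzOnWith L fm (cube N))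
    (hf_nonneg : ∀ v ∈ cube N, ∀ i j, i ≠ j → 0 ≤ fp v i j ∧ 0 ≤ fm v i j)
    (hfp_one : ∀ v ∈ cube N, ∀ i j, i ≠ j → v i j = 1 → fp v i j = 0)
    (hfm_zero : ∀ v ∈ cube N, ∀ i j, i ≠ j → v i j = 0 → fm v i j = 0)
    (hw : ∀ i j, i ≠ j → ∀ t : ℝ, 0 ≤ t →
      HasDerivAt (fun s => w s i j)
        (φ (x t j - x t i) * fp (w t) i j - (1 - φ (x t j - x t i)) * fm (w t) i j) t)
    (hwdiag' : ∀ i, ∀ t : ℝ, 0 ≤ t → HasDerivAt (fun s => w s i i) (0:ℝ) t)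
    (c_φ : ℝ) (hc_φ : 0 < c_φ)
    (hφc : ∀ r ∈ Set.Icc (-2:ℝ) 2, c_φ < φ r)
    (c_f : ℝ) (hc_f : 0 < c_f)
    (hfp_pos : ∀ v ∈ cube N, ∀ i j, i ≠ j → v i j = 0 → c_f < fp v i j) :
    Tendsto (fun t => ⨆ i, ⨆ j, |x t j - x t i|) atTop (𝓝 0) := by
  -- velocity
  obtain ⟨V, hV⟩ : ∃ V : Fin N → ℝ → ℝ, V = fun i t =>
    (1 / ∑ j, w t i j) * ∑ j, w t i j * φ (x t j - x t i) * (x t j - x t i) := ⟨_, rfl⟩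
  have hxV : ∀ i, ∀ t : ℝ, 0 ≤ t → HasDerivAt (fun s => x s i) (V i t) t := by
    rw [hV]; exact hx
  have hder : ∀ p : Fin N × Fin N, ∀ t, 0 ≤ t →
      HasDerivAt (fun s => x s p.1 - x s p.2) (V p.1 t - V p.2 t) t :=
    fun p t ht => (hxV p.1 t ht).sub (hxV p.2 t ht)
  -- extremal pair estimate
  have ext : ∀ (i j : Fin N) (t : ℝ), 0 ≤ t → (∀ k l, x t k - x t l ≤ x t i - x t j) →
      ∀ δ c : ℝ, 0 ≤ δ → 0 ≤ c → δ ≤ w t i j → δ ≤ w t j i → c ≤ φ (x t j - x t i) →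
      V i t - V j t ≤ - 2 * ((1 / N) * (δ * c)) * (x t i - x t j) := by
    intro i j t ht hmax δ c hδ hc h1 h2 h3
    have a1 := vel_bound (w t i) (fun k => φ (x t k - x t i)) (fun k => x t k - x t i) i j
      (hw01 t ht i) (hwdiag t ht i) (fun k => (hφ_range _).1)
      (fun k => by have := hmax k j; linarith) δ c hδ hc h1 h3
    have a2 := vel_bound (w t j) (fun k => φ (x t k - x t j)) (fun k => -(x t k - x t j)) j i
      (hw01 t ht j) (hwdiag t ht j) (fun k => (hφ_range _).1)
      (fun k => by have := hmax i k; linarith) δ c hδ hc h2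
      (by have := hφ_even (x t j - x t i); rw [neg_sub] at this; simpa [this] using h3)
    simp only [mul_neg, Finset.sum_neg_distrib] at a2
    rw [hV]
    simp only at a1 ⊢
    nlinarith
  -- diameter at most two
  have hD2 : ∀ t, 0 ≤ t → ∀ i j, x t i - x t j ≤ 2 := by
    intro t ht i j
    refine le_of_forall_pos_le_add fun ε hε => ?_
    have hε' : 0 < ε / (1 + t) := by positivity
    have := barrier_aux (fun p : Fin N × Fin N => fun s => x s p.1 - x s p.2)
      (fun p t => V p.1 t - V p.2 t) (fun s => 2 + ε / (1 + t) * s) (fun _ => ε / (1 + t)) 0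
      hder
      (fun s _ => by simpa using ((hasDerivAt_id s).const_mul (ε / (1 + t))).const_add 2)
      (fun p => by
        have h1 := (hx0 p.1).2
        have h2 := (hx0 p.2).1
        simp only [mul_zero, add_zero]
        linarith)
      (fun p s hs heq hall => by
        have := ext p.1 p.2 s hs (fun k l => by have := hall (k, l); simp only at this heq; linarith)
          0 0 le_rfl le_rfl (hw01 s hs _ _).1 (hw01 s hs _ _).1 (hφ_range _).1
        simp only [mul_zero, zero_mul] at this
        exact this.trans_lt hε') t ht (i, j)
    skip
    have h3 : ε / (1 + t) * t ≤ ε := by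
      rw [div_mul_eq_mul_div, div_le_iff₀ (by positivity)]
      nlinarith
    linarith
  have hφt : ∀ t, 0 ≤ t → ∀ i j, c_φ ≤ φ (x t j - x t i) := by
    intro t ht i j
    refine (hφc _ ⟨?_, hD2 t ht j i⟩).le
    have := hD2 t ht i j
    linarith
  -- weights
  obtain ⟨Lp, hLp⟩ := hfp_lip
  obtain ⟨Lm, hLm⟩ := hfm_lip
  have hbound : ∀ v ∈ cube N, ∀ i j, i ≠ j →
      c_f - Lp * v i j ≤ fp v i j ∧ fm v i j ≤ Lm * v i j := by
    intro v hv i j hij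
    obtain ⟨v0, hv0⟩ : ∃ v0 : Fin N → Fin N → ℝ,
      v0 = fun a b => if a = i ∧ b = j then 0 else v a b := ⟨_, rfl⟩
    have hv0c : v0 ∈ cube N := by
      intro a b
      rw [hv0]
      by_cases hab : a = i ∧ b = j
      · simp [hab]
      · simp only [hab, if_false]; exact hv a b
    have hv0z : v0 i j = 0 := by simp [hv0]
    have hdist : dist v v0 ≤ v i j := by
      refine (dist_pi_le_iff (hv i j).1).2 fun a => (dist_pi_le_iff (hv i j).1).2 fun b => ?_
      rw [hv0]
      by_cases hab : a = i ∧ b = j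
      · obtain ⟨rfl, rfl⟩ := hab
        simp [abs_of_nonneg (hv a b).1]
      · simp only [hab, if_false, dist_self]; exact (hv i j).1
    have e : ∀ (L : NNReal) (f : (Fin N → Fin N → ℝ) → (Fin N → Fin N → ℝ)),
        LipschitzOnWith L f (cube N) → |f v i j - f v0 i j| ≤ L * v i j := by
      intro L f hf
      calc |f v i j - f v0 i j| = dist (f v i j) (f v0 i j) := rfl
        _ ≤ dist (f v i) (f v0 i) := dist_le_pi_dist _ _ j
        _ ≤ dist (f v) (f v0) := dist_le_pi_dist _ _ i
        _ ≤ L * dist v v0 := hf.dist_le_mul v hv v0 hv0c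
        _ ≤ L * v i j := mul_le_mul_of_nonneg_left hdist L.2
    have e1 := abs_le.1 (e Lp fp hLp)
    have e2 := abs_le.1 (e Lm fm hLm)
    have p1 := hfp_pos v0 hv0c i j hij hv0z
    have p2 := hfm_zero v0 hv0c i j hij hv0z
    constructor <;> linarith [e1.1, e2.2]
  obtain ⟨b, hb⟩ : ∃ b : ℝ, b = c_φ * Lp + Lm + 1 := ⟨_, rfl⟩
  obtain ⟨q, hq⟩ : ∃ q : ℝ, q = c_φ * c_f / (2 * b) := ⟨_, rfl⟩
  have hLp0 : (0:ℝ) ≤ Lp := Lp.2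
  have hLm0 : (0:ℝ) ≤ Lm := Lm.2
  have hbpos : 0 < b := by rw [hb]; positivity
  have hqpos : 0 < q := by rw [hq]; positivity
  have hbq : b * q = c_φ * c_f / 2 := by rw [hq]; field_simp
  have hac : 0 < c_φ * c_f := by positivity
  have hwlow : ∀ i j, i ≠ j → ∀ t, 0 ≤ t → q * (1 - Real.exp (-b * t)) ≤ w t i j := by
    intro i j hij t ht
    have := barrier_aux (fun _ : Unit => fun s => - w s i j)
      (fun _ t => -(φ (x t j - x t i) * fp (w t) i j - (1 - φ (x t j - x t i)) * fm (w t) i j))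
      (fun s => q * (Real.exp (-b * s) - 1)) (fun s => q * (Real.exp (-b * s) * (-b * 1))) 0
      (fun _ s hs => (hw i j hij s hs).neg)
      (fun s _ => ((((hasDerivAt_id s).const_mul (-b)).exp.sub_const 1).const_mul q))
      (fun _ => by simpa using (hw01 0 le_rfl i j).1)
      (fun _ s hs heq _ => by
        have hc : w s ∈ cube N := hw01 s hs
        obtain ⟨b1, b2⟩ := hbound (w s) hc i j hij
        obtain ⟨n1, n2⟩ := hf_nonneg (w s) hc i j hij
        have f1 := hφt s hs i j
        have f2 := hφ_range (x s j - x s i)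
        have g1 : c_φ * fp (w s) i j ≤ φ (x s j - x s i) * fp (w s) i j :=
          mul_le_mul_of_nonneg_right f1 n1
        have g2 : c_φ * (c_f - Lp * w s i j) ≤ c_φ * fp (w s) i j :=
          mul_le_mul_of_nonneg_left b1 hc_φ.le
        have g3 : (1 - φ (x s j - x s i)) * fm (w s) i j ≤ fm (w s) i j := by
          nlinarith [mul_nonneg f2.1 n2]
        have hw0 := (hw01 s hs i j).1
        have g4 : c_φ * c_f - b * w s i j ≤
            φ (x s j - x s i) * fp (w s) i j - (1 - φ (x s j - x s i)) * fm (w s) i j := by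
          rw [hb]; nlinarith
        have hws : w s i j = q - q * Real.exp (-b * s) := by
          linarith
        have : b * w s i j = c_φ * c_f / 2 - b * q * Real.exp (-b * s) := by
          rw [hws, ← hbq]; ring
        skip
        nlinarith) t ht ()
    skip
    linarith
  obtain ⟨δ, hδ⟩ : ∃ δ : ℝ, δ = q * (1 - Real.exp (-b)) := ⟨_, rfl⟩
  have hδpos : 0 < δ := by
    rw [hδ]
    have : Real.exp (-b) < 1 := by rw [Real.exp_lt_one_iff]; linarith
    exact mul_pos hqpos (by linarith)
  have hwδ : ∀ i j, i ≠ j → ∀ t, 1 ≤ t → δ ≤ w t i j := by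
    intro i j hij t ht
    refine le_trans ?_ (hwlow i j hij t (by linarith))
    rw [hδ]
    have : Real.exp (-b * t) ≤ Real.exp (-b) := Real.exp_le_exp.2 (by nlinarith)
    exact mul_le_mul_of_nonneg_left (by linarith) hqpos.le
  -- exponential decay
  have hNpos : (0:ℝ) < N := by exact_mod_cast hN
  obtain ⟨κ, hκ⟩ : ∃ κ : ℝ, κ = (1 / N) * (δ * c_φ) := ⟨_, rfl⟩
  have hκpos : 0 < κ := by rw [hκ]; positivity
  have hdecay : ∀ t, 1 ≤ t → ∀ i j, x t i - x t j ≤ 2 * Real.exp (-κ * (t - 1)) := by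
    intro t ht i j
    refine barrier_aux (fun p : Fin N × Fin N => fun s => x s p.1 - x s p.2)
      (fun p t => V p.1 t - V p.2 t) (fun s => 2 * Real.exp (-κ * (s - 1)))
      (fun s => 2 * (Real.exp (-κ * (s - 1)) * (-κ * 1))) 1
      (fun p s hs => hder p s (by linarith))
      (fun s _ => ((((hasDerivAt_id s).sub_const 1).const_mul (-κ)).exp.const_mul 2))
      (fun p => by simpa using hD2 1 zero_le_one p.1 p.2)
      (fun p s hs heq hall => ?_) t ht (i, j)
    skip
    have hE : 0 < Real.exp (-κ * (s - 1)) := Real.exp_pos _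
    have hs0 : 0 ≤ s := by linarith
    have hne : p.1 ≠ p.2 := by
      intro h
      rw [h] at heq
      linarith
    have := ext p.1 p.2 s hs0 (fun k l => by have := hall (k, l); simp only at this; linarith)
      δ c_φ hδpos.le hc_φ.le (hwδ _ _ hne s hs) (hwδ _ _ hne.symm s hs) (hφt s hs0 _ _)
    rw [← hκ, heq] at this
    nlinarith [mul_pos hκpos hE]
  have : Nonempty (Fin N) := ⟨⟨0, hN⟩⟩
  have hlim : Tendsto (fun t => 2 * Real.exp (-κ * (t - 1))) atTop (𝓝 0) := by
    have h1 : Tendsto (fun t : ℝ => κ * (t - 1)) atTop atTop :=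
      (tendsto_atTop_add_const_right atTop (-1) tendsto_id).const_mul_atTop hκpos
    have h2 := (Real.tendsto_exp_neg_atTop_nhds_zero.comp h1).const_mul 2
    simpa [Function.comp_def] using h2
  refine tendsto_of_tendsto_of_tendsto_of_le_of_le' tendsto_const_nhds hlim ?_ ?_
  · exact Eventually.of_forall fun t =>
      Real.iSup_nonneg fun i => Real.iSup_nonneg fun j => abs_nonneg _
  · filter_upwards [eventually_ge_atTop 1] with t ht
    refine ciSup_le fun i => ciSup_le fun j => abs_le.2 ⟨?_, hdecay t ht j i⟩
    have := hdecay t ht i j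
    linarith
end

section
/- Suppose there is a constant c_φ > 0 with φ(r) > c_φ for all r ∈ [−2,2], and that the system follows memory weight dynamics. Then the population reaches consensus (D(t) → 0 as t → ∞) and the network becomes fully connected with limiting edge weight φ(0): for all i ≠ j, w_{ij}(t) → φ(0) as t → ∞. -/
open Filter Topology MeasureTheory

/-- Maximum principle for a finite family of differentiable functions. -/
lemma max_principle {ι : Type*} [Fintype ι] (y y' : ι → ℝ → ℝ) (a C : ℝ)
    (h0 : ∀ p, y p a ≤ C)
    (hd : ∀ p t, a ≤ t → HasDerivAt (y p) (y' p t) t)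
    (hm : ∀ p t, a ≤ t → (∀ q, y q t ≤ y p t) → y' p t ≤ 0) :
    ∀ p t, a ≤ t → y p t ≤ C := by
  intro p b hab
  have key : ∀ ε : ℝ, 0 < ε → y p b - ε * (b - a) ≤ C := by
    intro ε hε
    have hex : ∀ q, ∃ s ∈ Set.Icc a b, ∀ t ∈ Set.Icc a b,
        y q t - ε * (t - a) ≤ y q s - ε * (s - a) := by
      intro q
      have hc : ContinuousOn (fun t => y q t - ε * (t - a)) (Set.Icc a b) := by
        apply ContinuousOn.sub
        · exact fun t ht => (hd q t ht.1).continuousAt.continuousWithinAt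
        · fun_prop
      obtain ⟨s, hs, hs'⟩ := isCompact_Icc.exists_isMaxOn (Set.nonempty_Icc.2 hab) hc
      exact ⟨s, hs, fun t ht => hs' ht⟩
    choose s hs hsmax using hex
    obtain ⟨q, -, hq⟩ := Finset.exists_max_image Finset.univ
      (fun q => y q (s q) - ε * (s q - a)) ⟨p, Finset.mem_univ p⟩
    have hall : ∀ r, ∀ t ∈ Set.Icc a b, y r t - ε * (t - a) ≤ y q (s q) - ε * (s q - a) :=
      fun r t ht => (hsmax r t ht).trans (hq r (Finset.mem_univ r))
    have hqa : s q = a := by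
      by_contra hne
      have hlt : a < s q := lt_of_le_of_ne (hs q).1 (Ne.symm hne)
      have h1 : y' q (s q) ≤ 0 := by
        apply hm q _ (hs q).1
        intro r
        have := hall r (s q) (hs q)
        linarith
      have h2 : HasDerivAt (fun t => y q t - ε * (t - a)) (y' q (s q) - ε) (s q) := by
        have := (hd q (s q) (hs q).1).sub (((hasDerivAt_id (s q)).sub_const a).const_mul ε)
        exact this.congr_deriv (by simp)
      have h3 := h2.hasDerivWithinAt (s := Set.Iio (s q))
      rw [hasDerivWithinAt_iff_tendsto_slope' (by simp)] at h3
      have h4 : 0 ≤ y' q (s q) - ε := by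
        refine ge_of_tendsto h3 ?_
        filter_upwards [Ioo_mem_nhdsLT hlt] with t ht
        rw [slope_def_field]
        apply div_nonneg_of_nonpos
        · have := hsmax q t ⟨ht.1.le, ht.2.le.trans (hs q).2⟩
          linarith
        · linarith [ht.2]
      linarith
    have h5 := hall p b ⟨hab, le_rfl⟩
    rw [hqa] at h5
    have := h0 q
    linarith
  by_contra! hlt
  have hpos : 0 < b - a + 1 := by linarith
  have h6 := key ((y p b - C) / (b - a + 1)) (div_pos (by linarith) hpos)
  have h7 : (y p b - C) / (b - a + 1) * (b - a + 1) = y p b - C := by field_simp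
  have h8 : 0 < (y p b - C) / (b - a + 1) := div_pos (by linarith) hpos
  nlinarith

lemma decay (u u' : ℝ → ℝ) (a : ℝ) (hd : ∀ t, a ≤ t → HasDerivAt u (u' t) t)
    (h : ∀ t, a ≤ t → u' t ≤ - u t) : ∀ t, a ≤ t → u t ≤ u a * Real.exp a * Real.exp (-t) := by
  intro t ht
  have := max_principle (ι := Unit) (fun _ s => u s * Real.exp s)
    (fun _ s => u' s * Real.exp s + u s * Real.exp s) a (u a * Real.exp a) (fun _ => le_rfl)
    (fun _ s hs => (hd s hs).mul (Real.hasDerivAt_exp s))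
    (fun _ s hs _ => by nlinarith [h s hs, Real.exp_pos s]) () t ht
  rw [Real.exp_neg, ← div_eq_mul_inv, le_div_iff₀ (Real.exp_pos t)]
  exact this

lemma relax_upper (u g : ℝ → ℝ) (G : ℝ) (hd : ∀ t, 0 ≤ t → HasDerivAt u (g t - u t) t)
    (hg : Tendsto g atTop (𝓝 G)) (ε : ℝ) (hε : 0 < ε) : ∀ᶠ t in atTop, u t < G + ε := by
  obtain ⟨a, ha⟩ := eventually_atTop.1
    ((hg.eventually_lt_const (show G < G + ε / 2 by linarith)).and (eventually_ge_atTop 0))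
  have hb := decay (fun t => u t - (G + ε / 2)) (fun t => g t - u t) a
    (fun t ht => (hd t (ha t ht).2).sub_const _) (fun t ht => by linarith [(ha t ht).1])
  have hl : Tendsto (fun t => (u a - (G + ε / 2)) * Real.exp a * Real.exp (-t)) atTop (𝓝 0) := by
    simpa using Real.tendsto_exp_neg_atTop_nhds_zero.const_mul ((u a - (G + ε / 2)) * Real.exp a)
  filter_upwards [hl.eventually_lt_const (show 0 < ε / 2 by linarith), eventually_ge_atTop a]
    with t h1 h2
  have := hb t h2
  linarith

lemma relax (u g : ℝ → ℝ) (G : ℝ) (hd : ∀ t, 0 ≤ t → HasDerivAt u (g t - u t) t)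
    (hg : Tendsto g atTop (𝓝 G)) : Tendsto u atTop (𝓝 G) := by
  rw [Metric.tendsto_nhds]
  intro ε hε
  filter_upwards [relax_upper u g G hd hg ε hε,
    relax_upper (fun t => - u t) (fun t => - g t) (-G)
      (fun t ht => (hd t ht).neg.congr_deriv (by ring)) hg.neg ε hε] with t h1 h2
  rw [Real.dist_eq, abs_lt]
  constructor <;> linarith

lemma avg_bound {N : ℕ} (hN : 1 ≤ N) (v a d : Fin N → ℝ) (κ : ℝ) (hκ : 0 ≤ κ)
    (hk1 : 0 < ∑ j, v j) (hkN : ∑ j, v j ≤ N) (ha : ∀ j, κ ≤ a j) (hd : ∀ j, d j ≤ 0) :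
    (1 / ∑ j, v j) * ∑ j, a j * d j ≤ κ / N * ∑ j, d j := by
  have hN' : (0:ℝ) < N := by exact_mod_cast hN
  have h1 : ∑ j, a j * d j ≤ κ * ∑ j, d j := by
    rw [Finset.mul_sum]
    exact Finset.sum_le_sum fun j _ => mul_le_mul_of_nonpos_right (ha j) (hd j)
  have h2 : ∑ j, d j ≤ 0 := Finset.sum_nonpos fun j _ => hd j
  have h3 : 1 / (N:ℝ) ≤ 1 / ∑ j, v j := one_div_le_one_div_of_le hk1 hkN
  have h4 : κ * ∑ j, d j ≤ 0 := mul_nonpos_of_nonneg_of_nonpos hκ h2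
  calc (1 / ∑ j, v j) * ∑ j, a j * d j ≤ (1 / ∑ j, v j) * (κ * ∑ j, d j) :=
        mul_le_mul_of_nonneg_left h1 (by positivity)
    _ ≤ 1 / (N:ℝ) * (κ * ∑ j, d j) := mul_le_mul_of_nonpos_right h3 h4
    _ = κ / N * ∑ j, d j := by ring

theorem stmt1
    (N : ℕ) (hN : 1 ≤ N)
    (x : ℝ → Fin N → ℝ) (w : ℝ → Fin N → Fin N → ℝ)
    (φ : ℝ → ℝ)
    (hφ_lip : ∃ L : NNReal, LipschitzWith L φ)
    (hφ_range : ∀ r : ℝ, φ r ∈ Set.Icc (0:ℝ) 1)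
    (hφ_even : ∀ r : ℝ, φ (-r) = φ r)
    (hw01 : ∀ t : ℝ, 0 ≤ t → ∀ i j, w t i j ∈ Set.Icc (0:ℝ) 1)
    (hwdiag : ∀ t : ℝ, 0 ≤ t → ∀ i, w t i i = 1)
    (hx0 : ∀ i, x 0 i ∈ Set.Icc (-1:ℝ) 1)
    (hx : ∀ i, ∀ t : ℝ, 0 ≤ t →
      HasDerivAt (fun s => x s i)
        ((1 / ∑ j, w t i j) * ∑ j, w t i j * φ (x t j - x t i) * (x t j - x t i)) t)
    (hw : ∀ i j, i ≠ j → ∀ t : ℝ, 0 ≤ t →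
      HasDerivAt (fun s => w s i j) (φ (x t j - x t i) - w t i j) t)
    (c_φ : ℝ) (hc_φ : 0 < c_φ)
    (hφc : ∀ r ∈ Set.Icc (-2:ℝ) 2, c_φ < φ r)
    :
    Tendsto (fun t => ⨆ i, ⨆ j, |x t j - x t i|) atTop (𝓝 0) ∧
    ∀ i j, i ≠ j → Tendsto (fun t => w t i j) atTop (𝓝 (φ 0)) := by
  have hne : Nonempty (Fin N) := ⟨⟨0, hN⟩⟩
  have hN' : (0:ℝ) < N := by exact_mod_cast hN
  have hk1 : ∀ t, 0 ≤ t → ∀ i, 0 < ∑ j, w t i j := by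
    intro t ht i
    have := Finset.single_le_sum (f := fun j => w t i j)
      (fun j _ => (hw01 t ht i j).1) (Finset.mem_univ i)
    simp only [hwdiag t ht i] at this
    linarith
  have hkN : ∀ t, 0 ≤ t → ∀ i, ∑ j, w t i j ≤ N := by
    intro t ht i
    have := Finset.sum_le_sum (s := Finset.univ) (fun j _ => (hw01 t ht i j).2)
    simpa using this
  -- opinions stay in the interval
  have hpos : ∀ t, 0 ≤ t → ∀ i j, 0 ≤ w t i j * φ (x t j - x t i) :=
    fun t ht i j => mul_nonneg (hw01 t ht i j).1 (hφ_range _).1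
  have hup : ∀ i t, 0 ≤ t → x t i ≤ 1 := by
    refine max_principle (fun i t => x t i) _ 0 1 (fun i => (hx0 i).2) hx ?_
    intro i t ht hmax
    have := avg_bound hN (w t i) (fun j => w t i j * φ (x t j - x t i))
      (fun j => x t j - x t i) 0 le_rfl (hk1 t ht i) (hkN t ht i) (hpos t ht i)
      (fun j => sub_nonpos.2 (hmax j))
    simpa using this
  have hlo : ∀ i t, 0 ≤ t → -x t i ≤ 1 := by
    refine max_principle (fun i t => -x t i) _ 0 1 (fun i => by linarith [(hx0 i).1])
      (fun i t ht => (hx i t ht).neg) ?_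
    intro i t ht hmax
    have := avg_bound hN (w t i) (fun j => w t i j * φ (x t j - x t i))
      (fun j => -(x t j - x t i)) 0 le_rfl (hk1 t ht i) (hkN t ht i) (hpos t ht i)
      (fun j => by have := hmax j; linarith)
    simpa [-neg_sub] using this
  have hφ' : ∀ t, 0 ≤ t → ∀ i j, c_φ < φ (x t j - x t i) := by
    intro t ht i j
    apply hφc
    constructor <;> linarith [hup i t ht, hup j t ht, hlo i t ht, hlo j t ht]
  have hc1 : c_φ < 1 := (hφc 0 (by norm_num)).trans_le (hφ_range 0).2
  -- weights bounded below
  have hwlo : ∀ t, 1 ≤ t → ∀ i j, c_φ / 2 ≤ w t i j := by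
    intro t ht i j
    have ht0 : (0:ℝ) ≤ t := by linarith
    by_cases hij : i = j
    · subst hij
      rw [hwdiag t ht0]; linarith
    have h1 := decay (fun s => c_φ - w s i j) _ 0 (fun s hs => (hw i j hij s hs).const_sub c_φ)
      (fun s hs => by linarith [hφ' s hs i j]) t ht0
    have h2 : Real.exp (-t) ≤ 1 / 2 := by
      rw [Real.exp_neg, ← one_div]
      apply one_div_le_one_div_of_le (by norm_num)
      linarith [Real.add_one_le_exp t]
    have h3 := (hw01 0 le_rfl i j).1
    simp only [Real.exp_zero, mul_one] at h1
    nlinarith [Real.exp_pos (-t)]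
  set κ := c_φ / 2 * c_φ with hκ
  have hκ0 : 0 < κ := by positivity
  have hκa : ∀ t, 1 ≤ t → ∀ i j, κ ≤ w t i j * φ (x t j - x t i) := by
    intro t ht i j
    exact mul_le_mul (hwlo t ht i j) (hφ' t (by linarith) i j).le hc_φ.le
      ((by positivity : 0 ≤ c_φ / 2).trans (hwlo t ht i j))
  have hdec : ∀ p : Fin N × Fin N, ∀ t, 1 ≤ t →
      (x t p.2 - x t p.1) * Real.exp (κ * t) ≤ 2 * Real.exp (κ * 1) := by
    refine max_principle (fun (p : Fin N × Fin N) t => (x t p.2 - x t p.1) * Real.exp (κ * t))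
      _ 1 _ ?_ (fun p t ht => ((hx p.2 t (by linarith)).sub (hx p.1 t (by linarith))).mul
        (((hasDerivAt_id t).const_mul κ).exp)) ?_
    · intro p
      apply mul_le_mul_of_nonneg_right _ (Real.exp_pos _).le
      linarith [hup p.2 1 zero_le_one, hlo p.1 1 zero_le_one]
    · rintro ⟨i, j⟩ t ht hmax
      have ht0 : (0:ℝ) ≤ t := by linarith
      have hE := Real.exp_pos (κ * t)
      have hm : ∀ q : Fin N × Fin N, x t q.2 - x t q.1 ≤ x t j - x t i :=
        fun q => le_of_mul_le_mul_right (hmax q) hE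
      have A := avg_bound hN (w t j) (fun l => w t j l * φ (x t l - x t j))
        (fun l => x t l - x t j) κ hκ0.le (hk1 t ht0 j) (hkN t ht0 j) (hκa t ht j)
        (fun l => by have := hm (i, l); simp only at this; linarith)
      have B := avg_bound hN (w t i) (fun l => w t i l * φ (x t l - x t i))
        (fun l => -(x t l - x t i)) κ hκ0.le (hk1 t ht0 i) (hkN t ht0 i) (hκa t ht i)
        (fun l => by have := hm (l, j); simp only at this; linarith)
      simp only [mul_neg, Finset.sum_neg_distrib] at B
      have S : κ / N * ∑ l, (x t l - x t j) - κ / N * ∑ l, (x t l - x t i)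
          = - κ * (x t j - x t i) := by
        rw [← mul_sub, ← Finset.sum_sub_distrib]
        simp only [sub_sub_sub_cancel_left, Finset.sum_const, Finset.card_univ, Fintype.card_fin,
          nsmul_eq_mul]
        field_simp
        ring
      simp only [id, mul_one, Pi.sub_apply]
      have F : (1 / ∑ l, w t j l) * ∑ l, w t j l * φ (x t l - x t j) * (x t l - x t j)
          - (1 / ∑ l, w t i l) * ∑ l, w t i l * φ (x t l - x t i) * (x t l - x t i)
          + κ * (x t j - x t i) ≤ 0 := by linarith
      have := mul_nonpos_of_nonpos_of_nonneg F hE.le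
      linarith
  have hdec' : ∀ t, 1 ≤ t → ∀ i j, |x t j - x t i| ≤ 2 * Real.exp (κ * 1) * Real.exp (-(κ * t)) := by
    have h1 : ∀ t, 1 ≤ t → ∀ i j,
        x t j - x t i ≤ 2 * Real.exp (κ * 1) * Real.exp (-(κ * t)) := by
      intro t ht i j
      rw [Real.exp_neg, ← div_eq_mul_inv, le_div_iff₀ (Real.exp_pos _)]
      exact hdec (i, j) t ht
    intro t ht i j
    exact abs_le.2 ⟨by linarith [h1 t ht j i], h1 t ht i j⟩
  have hlim : Tendsto (fun t => 2 * Real.exp (κ * 1) * Real.exp (-(κ * t))) atTop (𝓝 0) := by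
    have := (Real.tendsto_exp_neg_atTop_nhds_zero.comp
      (tendsto_id.const_mul_atTop hκ0)).const_mul (2 * Real.exp (κ * 1))
    simpa using this
  constructor
  · refine tendsto_of_tendsto_of_tendsto_of_le_of_le' tendsto_const_nhds hlim
      (Eventually.of_forall fun t => ?_) ?_
    · exact Real.iSup_nonneg fun i => Real.iSup_nonneg fun j => abs_nonneg _
    · filter_upwards [eventually_ge_atTop 1] with t ht
      exact ciSup_le fun i => ciSup_le fun j => hdec' t ht i j
  · intro i j hij
    obtain ⟨L, hL⟩ := hφ_lip
    refine relax _ (fun t => φ (x t j - x t i)) _ (hw i j hij) ?_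
    have h0 : Tendsto (fun t => x t j - x t i) atTop (𝓝 0) := by
      apply squeeze_zero_norm' _ hlim
      filter_upwards [eventually_ge_atTop 1] with t ht
      exact hdec' t ht i j
    exact (hL.continuous.tendsto 0).comp h0
end

section
/- Suppose there is a constant c > 0 with φ(r) > c for all r ∈ [−2,2], and that the system follows memory weight dynamics. Then for all t ≥ 0 the opinion diameter satisfies D(t) ≤ exp(−c²·(t + e^{−t} − 1)) · D(0). -/
open Filter Topology MeasureTheory

lemma max_principle_s2 {ι : Type*} [Fintype ι] [Nonempty ι] (f f' : ι → ℝ → ℝ) (M : ℝ)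
    (hf : ∀ i, ∀ t : ℝ, 0 ≤ t → HasDerivAt (f i) (f' i t) t)
    (hmax : ∀ i, ∀ t : ℝ, 0 ≤ t → (∀ j, f j t ≤ f i t) → f' i t ≤ 0)
    (h0 : ∀ i, f i 0 ≤ M) : ∀ i, ∀ t : ℝ, 0 ≤ t → f i t ≤ M := by
  intro i t ht
  have hne : (Finset.univ : Finset ι).Nonempty := Finset.univ_nonempty
  set g : ℝ → ℝ := fun s => Finset.univ.sup' hne (fun i => f i s) with hg
  have hle : ∀ s i, f i s ≤ g s := fun s i =>
    Finset.le_sup' (fun i => f i s) (Finset.mem_univ i)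
  have hcont : ContinuousOn g (Set.Icc 0 t) := by
    apply ContinuousOn.finset_sup'_apply
    intro j _ s hs
    exact (hf j s hs.1).continuousAt.continuousWithinAt
  have key : ∀ ⦃s⦄, s ∈ Set.Icc 0 t → g s ≤ (fun _ => M) s := by
    refine image_le_of_liminf_slope_right_le_deriv_boundary (B' := fun _ => 0) hcont ?_ ?_ ?_ ?_
    · exact Finset.sup'_le _ _ (fun j _ => h0 j)
    · exact continuousOn_const
    · intro s _
      exact hasDerivWithinAt_const _ _ _
    · intro s hs r hr
      apply Eventually.frequently
      have h1 : ∀ j, ∀ᶠ z in 𝓝[>] s, f j z < g s + r * (z - s) := by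
        intro j
        rcases eq_or_lt_of_le (hle s j) with h | h
        · have hd : f' j s < r := lt_of_le_of_lt
            (hmax j s hs.1 (fun k => by rw [h]; exact hle s k)) hr
          have h2 := (hf j s hs.1).hasDerivWithinAt (s := Set.Ioi s)
          rw [hasDerivWithinAt_iff_tendsto_slope' (by simp)] at h2
          filter_upwards [h2.eventually (gt_mem_nhds hd), self_mem_nhdsWithin] with z hz hzs
          have hzs' : 0 < z - s := sub_pos.2 hzs
          rw [slope_def_field, div_lt_iff₀ hzs'] at hz
          linarith
        · have hc1 : ContinuousAt (fun z => g s + r * (z - s) - f j z) s := by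
            have := (hf j s hs.1).continuousAt
            fun_prop
          have h3 := hc1.eventually (lt_mem_nhds (a := 0) (by simp; exact h))
          filter_upwards [nhdsWithin_le_nhds h3] with z hz
          linarith
      filter_upwards [eventually_all.2 h1, self_mem_nhdsWithin] with z hz hzs
      have hzs' : 0 < z - s := sub_pos.2 hzs
      rw [slope_def_field, div_lt_iff₀ hzs']
      have : g z < g s + r * (z - s) := (Finset.sup'_lt_iff hne).2 (fun j _ => hz j)
      linarith
  exact (hle t i).trans (key ⟨ht, le_refl t⟩)

lemma rate_bound {N : ℕ} (w p d : Fin N → ℝ) (i : Fin N) (a c : ℝ) (ha : 0 ≤ a) (hc : 0 ≤ c)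
    (hwi : w i = 1) (hw : ∀ j, w j ∈ Set.Icc (0:ℝ) 1) (hwa : ∀ j, a ≤ w j)
    (hp : ∀ j, c ≤ p j) (hd : ∀ j, d j ≤ 0) :
    (1 / ∑ j, w j) * ∑ j, w j * p j * d j ≤ (1 / (N:ℝ)) * (a * c * ∑ j, d j) := by
  have hk : 0 < ∑ j, w j := by
    have := Finset.single_le_sum (f := w) (fun j _ => (hw j).1) (Finset.mem_univ i)
    linarith
  have hkN : ∑ j, w j ≤ N := by
    have := Finset.sum_le_sum (s := Finset.univ) (fun j _ => (hw j).2)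
    simpa using this
  have h1 : ∑ j, w j * p j * d j ≤ a * c * ∑ j, d j := by
    rw [Finset.mul_sum]
    apply Finset.sum_le_sum
    intro j _
    apply mul_le_mul_of_nonpos_right _ (hd j)
    exact mul_le_mul (hwa j) (hp j) hc (hw j).1
  have h2 : a * c * ∑ j, d j ≤ 0 :=
    mul_nonpos_of_nonneg_of_nonpos (mul_nonneg ha hc) (Finset.sum_nonpos (fun j _ => hd j))
  calc _ ≤ (1 / ∑ j, w j) * (a * c * ∑ j, d j) :=
        mul_le_mul_of_nonneg_left h1 (by positivity)
    _ ≤ _ := mul_le_mul_of_nonpos_right (one_div_le_one_div_of_le hk hkN) h2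

theorem stmt2
    (N : ℕ) (hN : 1 ≤ N)
    (x : ℝ → Fin N → ℝ) (w : ℝ → Fin N → Fin N → ℝ)
    (φ : ℝ → ℝ)
    (hφ_lip : ∃ L : NNReal, LipschitzWith L φ)
    (hφ_range : ∀ r : ℝ, φ r ∈ Set.Icc (0:ℝ) 1)
    (hφ_even : ∀ r : ℝ, φ (-r) = φ r)
    (hw01 : ∀ t : ℝ, 0 ≤ t → ∀ i j, w t i j ∈ Set.Icc (0:ℝ) 1)
    (hwdiag : ∀ t : ℝ, 0 ≤ t → ∀ i, w t i i = 1)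
    (hx0 : ∀ i, x 0 i ∈ Set.Icc (-1:ℝ) 1)
    (hx : ∀ i, ∀ t : ℝ, 0 ≤ t →
      HasDerivAt (fun s => x s i)
        ((1 / ∑ j, w t i j) * ∑ j, w t i j * φ (x t j - x t i) * (x t j - x t i)) t)
    (hw : ∀ i j, i ≠ j → ∀ t : ℝ, 0 ≤ t →
      HasDerivAt (fun s => w s i j) (φ (x t j - x t i) - w t i j) t)
    (c : ℝ) (hc : 0 < c)
    (hφc : ∀ r ∈ Set.Icc (-2:ℝ) 2, c < φ r) :
    ∀ t : ℝ, 0 ≤ t →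
      (⨆ i, ⨆ j, |x t j - x t i|) ≤
        Real.exp (-(c ^ 2) * (t + Real.exp (-t) - 1)) * (⨆ i, ⨆ j, |x 0 j - x 0 i|) := by
  have : Nonempty (Fin N) := ⟨⟨0, hN⟩⟩
  have hNpos : (0:ℝ) < N := by exact_mod_cast hN
  have hk : ∀ t : ℝ, 0 ≤ t → ∀ i, 0 ≤ 1 / ∑ j, w t i j := fun t ht i =>
    one_div_nonneg.2 (Finset.sum_nonneg (fun j _ => (hw01 t ht i j).1))
  have hub : ∀ i, ∀ t : ℝ, 0 ≤ t → x t i ≤ 1 := by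
    refine max_principle_s2 (fun i s => x s i) _ 1 hx ?_ (fun i => (hx0 i).2)
    intro i t ht hm
    apply mul_nonpos_of_nonneg_of_nonpos (hk t ht i)
    apply Finset.sum_nonpos
    intro j _
    exact mul_nonpos_of_nonneg_of_nonpos (mul_nonneg (hw01 t ht i j).1 (hφ_range _).1)
      (sub_nonpos.2 (hm j))
  have hlb : ∀ i, ∀ t : ℝ, 0 ≤ t → -x t i ≤ 1 := by
    refine max_principle_s2 (fun i s => -x s i) _ 1 (fun i t ht => (hx i t ht).neg) ?_
      (fun i => by have := (hx0 i).1; linarith)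
    intro i t ht hm
    apply neg_nonpos.2
    apply mul_nonneg (hk t ht i)
    apply Finset.sum_nonneg
    intro j _
    exact mul_nonneg (mul_nonneg (hw01 t ht i j).1 (hφ_range _).1)
      (sub_nonneg.2 (by have := hm j; simpa using this))
  have hφx : ∀ t : ℝ, 0 ≤ t → ∀ i j, c ≤ φ (x t j - x t i) := by
    intro t ht i j
    apply (hφc _ _).le
    have := hub i t ht
    have := hub j t ht
    have := hlb i t ht
    have := hlb j t ht
    constructor <;> linarith
  have hc1 : c ≤ 1 := ((hφc 0 (by norm_num)).trans_le (hφ_range 0).2).le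
  have hexp1 : ∀ t : ℝ, 0 ≤ t → 0 ≤ 1 - Real.exp (-t) := fun t ht => by
    have := Real.exp_le_one_iff.2 (neg_nonpos.2 ht)
    linarith
  have hwlow : ∀ t : ℝ, 0 ≤ t → ∀ i j, c * (1 - Real.exp (-t)) ≤ w t i j := by
    intro t ht i j
    by_cases hij : i = j
    · subst hij
      rw [hwdiag t ht i]
      have := Real.exp_pos (-t)
      nlinarith
    · have h := max_principle_s2 (ι := Unit) (fun _ s => -((w s i j - c) * Real.exp s))
        (fun _ s => -((φ (x s j - x s i) - w s i j) * Real.exp s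
          + (w s i j - c) * Real.exp s)) c
        (fun _ s hs => (((hw i j hij s hs).sub_const c).mul (Real.hasDerivAt_exp s)).neg)
        (fun _ s hs _ => by
          have h1 := hφx s hs i j
          have h2 := Real.exp_pos s
          nlinarith)
        (fun _ => by
          have := (hw01 0 le_rfl i j).1
          simp; linarith) () t ht
      have h3 : Real.exp t * Real.exp (-t) = 1 := by rw [← Real.exp_add]; simp
      have h4 := mul_le_mul_of_nonneg_right h (Real.exp_pos (-t)).le
      have h5 : -((w t i j - c) * Real.exp t) * Real.exp (-t) = -(w t i j - c) := by
        linear_combination (-(w t i j - c)) * h3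
      rw [h5] at h4
      linarith
  set D0 := ⨆ i, ⨆ j, |x 0 j - x 0 i| with hD0
  have hD0le : ∀ i j, |x 0 j - x 0 i| ≤ D0 := by
    intro i j
    exact (le_ciSup (f := fun j => |x 0 j - x 0 i|) (Set.finite_range _).bddAbove j).trans
      (le_ciSup (f := fun i => ⨆ j, |x 0 j - x 0 i|) (Set.finite_range _).bddAbove i)
  let v : Fin N → ℝ → ℝ := fun i t =>
    (1 / ∑ j, w t i j) * ∑ j, w t i j * φ (x t j - x t i) * (x t j - x t i)
  have hE : ∀ t : ℝ, HasDerivAt (fun s => Real.exp (c ^ 2 * (s + Real.exp (-s) - 1)))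
      (Real.exp (c ^ 2 * (t + Real.exp (-t) - 1)) * (c ^ 2 * (1 - Real.exp (-t)))) t := by
    intro t
    have h1 : HasDerivAt (fun s : ℝ => Real.exp (-s)) (Real.exp (-t) * (-1)) t :=
      (hasDerivAt_neg t).exp
    have h2 := ((((hasDerivAt_id t).add h1).sub_const 1).const_mul (c ^ 2)).exp
    refine HasDerivAt.congr_deriv h2 ?_
    change Real.exp (c ^ 2 * (t + Real.exp (-t) - 1)) * _ = _
    ring
  have main := max_principle_s2 (ι := Fin N × Fin N)
    (fun p s => (x s p.1 - x s p.2) * Real.exp (c ^ 2 * (s + Real.exp (-s) - 1)))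
    (fun p t => (v p.1 t - v p.2 t) * Real.exp (c ^ 2 * (t + Real.exp (-t) - 1))
      + (x t p.1 - x t p.2) *
        (Real.exp (c ^ 2 * (t + Real.exp (-t) - 1)) * (c ^ 2 * (1 - Real.exp (-t))))) D0
    (fun p t ht => ((hx p.1 t ht).sub (hx p.2 t ht)).mul (hE t))
    (by
      rintro ⟨i, m⟩ t ht hm
      have hEp := Real.exp_pos (c ^ 2 * (t + Real.exp (-t) - 1))
      have hm' : ∀ a b, x t a - x t b ≤ x t i - x t m := fun a b =>
        le_of_mul_le_mul_right (hm (a, b)) hEp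
      have ha : 0 ≤ c * (1 - Real.exp (-t)) := mul_nonneg hc.le (hexp1 t ht)
      have h1 := rate_bound (w t i) (fun j => φ (x t j - x t i)) (fun j => x t j - x t i) i
        (c * (1 - Real.exp (-t))) c ha hc.le (hwdiag t ht i) (hw01 t ht i) (hwlow t ht i)
        (hφx t ht i) (fun j => by have := hm' j m; linarith)
      have h2 := rate_bound (w t m) (fun j => φ (x t j - x t m)) (fun j => -(x t j - x t m)) m
        (c * (1 - Real.exp (-t))) c ha hc.le (hwdiag t ht m) (hw01 t ht m) (hwlow t ht m)
        (hφx t ht m) (fun j => by have := hm' i j; linarith)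
      simp only [mul_neg, Finset.sum_neg_distrib] at h2
      have h3 : v i t - v m t ≤ -(c ^ 2 * (1 - Real.exp (-t)) * (x t i - x t m)) := by
        have h4 : (1 / (N:ℝ)) * (c * (1 - Real.exp (-t)) * c * ∑ j, (x t j - x t i)) -
            (1 / (N:ℝ)) * (c * (1 - Real.exp (-t)) * c * ∑ j, (x t j - x t m)) =
            -(c ^ 2 * (1 - Real.exp (-t)) * (x t i - x t m)) := by
          simp only [Finset.sum_sub_distrib, Finset.sum_const, Finset.card_univ,
            Fintype.card_fin, nsmul_eq_mul]
          field_simp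
          ring
        simp only [v]
        linarith
      have h5 := mul_le_mul_of_nonneg_right h3 hEp.le
      simp only
      linarith)
    (fun p => by
      have := (le_abs_self _).trans (hD0le p.2 p.1)
      simpa using this)
  intro t ht
  have hfin : ∀ i j, x t j - x t i ≤
      Real.exp (-(c ^ 2) * (t + Real.exp (-t) - 1)) * D0 := by
    intro i j
    have h := main (j, i) t ht
    simp only at h
    rw [neg_mul, Real.exp_neg, ← div_eq_inv_mul, le_div_iff₀ (Real.exp_pos _)]
    exact h
  refine ciSup_le fun i => ciSup_le fun j => abs_le'.2 ⟨hfin i j, ?_⟩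
  rw [neg_sub]
  exact hfin j i
end

section
/- Suppose the system follows logistic weight dynamics and there is a constant c ≥ 1/2 with φ(r) > c for all r ∈ [−2,2]. Assume the initial network is strongly connected: for any individuals i, j there exists a finite sequence i = i_0, i_1, …, i_m = j with w_{i_k i_{k+1}}(0) > 0 for every k. Then the population reaches consensus (D(t) → 0 as t → ∞), and for every pair i ≠ j: if w_{ij}(0) > 0 then w_{ij}(t) → 1 as t → ∞, while if w_{ij}(0) = 0 then w_{ij}(t) = 0 for all t ≥ 0. -/
open Filter Topology MeasureTheory

/-- A function with nonpositive derivative after time `s` stays below its value at `s`. -/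
lemma le_of_deriv_nonpos_after {f f' : ℝ → ℝ} {s : ℝ}
    (hf : ∀ t, s ≤ t → HasDerivAt f (f' t) t) (h : ∀ t, s ≤ t → f' t ≤ 0)
    {t u : ℝ} (ht : s ≤ t) (hu : t ≤ u) : f u ≤ f t := by
  have : AntitoneOn f (Set.Ici s) := by
    apply antitoneOn_of_deriv_nonpos (convex_Ici s)
    · intro t ht
      exact (hf t ht).continuousAt.continuousWithinAt
    · intro t ht
      rw [interior_Ici] at ht
      exact (hf t (le_of_lt ht)).differentiableAt.differentiableWithinAt
    · intro t ht
      rw [interior_Ici] at ht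
      rw [(hf t (le_of_lt ht)).deriv]
      exact h t (le_of_lt ht)
  exact this (Set.mem_Ici.2 ht) (Set.mem_Ici.2 (ht.trans hu)) hu

lemma gronwall_after {f f' : ℝ → ℝ} {s c : ℝ}
    (hf : ∀ t, s ≤ t → HasDerivAt f (f' t) t) (h : ∀ t, s ≤ t → f' t ≤ c * f t)
    {t : ℝ} (ht : s ≤ t) : f t * Real.exp (-c * t) ≤ f s * Real.exp (-c * s) := by
  have hd : ∀ t, s ≤ t → HasDerivAt (fun t => f t * Real.exp (-c * t))
      (f' t * Real.exp (-c * t) + f t * (Real.exp (-c * t) * (-c * 1))) t := by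
    intro t ht
    exact (hf t ht).mul (((hasDerivAt_id t).const_mul (-c)).exp)
  refine le_of_deriv_nonpos_after hd ?_ le_rfl ht
  intro t ht
  have := h t ht
  have he := Real.exp_pos (-c * t)
  nlinarith

lemma hasDerivAt_min_sq (r : ℝ) :
    HasDerivAt (fun r : ℝ => (min r 0) ^ 2) (2 * min r 0) r := by
  rcases lt_trichotomy r 0 with h | h | h
  · have h1 : HasDerivAt (fun r : ℝ => r ^ 2) (2 * r) r := by
      simpa using hasDerivAt_pow 2 r
    rw [min_eq_left h.le]
    refine h1.congr_of_eventuallyEq ?_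
    filter_upwards [Iio_mem_nhds h] with u hu
    rw [min_eq_left (le_of_lt hu)]
  · subst h
    rw [hasDerivAt_iff_isLittleO_nhds_zero]
    have h1 : (fun h : ℝ => h ^ 2) =o[𝓝 0] fun h => h := by
      simpa using Asymptotics.isLittleO_pow_pow (𝕜 := ℝ) (m := 1) (n := 2) (by norm_num)
    refine Asymptotics.IsBigO.trans_isLittleO ?_ h1
    refine Asymptotics.IsBigO.of_bound 1 (Filter.Eventually.of_forall fun u => ?_)
    simp only [zero_add, min_self, Real.norm_eq_abs, smul_eq_mul]
    rcases le_total u 0 with hu | hu <;> simp [hu]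
  · rw [min_eq_right h.le]
    have h1 : HasDerivAt (fun _ : ℝ => (0:ℝ)) (2 * 0) r := by
      simpa using hasDerivAt_const r (0:ℝ)
    refine h1.congr_of_eventuallyEq ?_
    filter_upwards [Ioi_mem_nhds h] with u hu
    rw [min_eq_right (le_of_lt hu)]
    simp

/-- Positivity is preserved by the averaging dynamics. -/
lemma averaging_nonneg {N : ℕ} {y : ℝ → Fin N → ℝ} {a : ℝ → Fin N → Fin N → ℝ} {s : ℝ}
    (ha0 : ∀ t, s ≤ t → ∀ i j, 0 ≤ a t i j) (ha1 : ∀ t, s ≤ t → ∀ i, ∑ j, a t i j ≤ 1)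
    (hy : ∀ i t, s ≤ t → HasDerivAt (fun u => y u i) (∑ j, a t i j * (y t j - y t i)) t)
    (h0 : ∀ i, 0 ≤ y s i) {t : ℝ} (ht : s ≤ t) (i : Fin N) : 0 ≤ y t i := by
  have haj : ∀ t, s ≤ t → ∀ i j, a t i j ≤ 1 := fun t ht i j =>
    (Finset.single_le_sum (f := fun j => a t i j) (fun j _ => ha0 t ht i j)
      (Finset.mem_univ j)).trans (ha1 t ht i)
  have hV : ∀ t, s ≤ t → HasDerivAt (fun u => ∑ i, (min (y u i) 0) ^ 2)
      (∑ i, 2 * min (y t i) 0 * ∑ j, a t i j * (y t j - y t i)) t := by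
    intro t ht
    apply HasDerivAt.fun_sum
    intro i _
    exact (hasDerivAt_min_sq (y t i)).comp t (hy i t ht)
  have hb : ∀ t, s ≤ t → (∑ i, 2 * min (y t i) 0 * ∑ j, a t i j * (y t j - y t i)) ≤
      (N : ℝ) * ∑ i, (min (y t i) 0) ^ 2 := by
    intro t ht
    have : ∀ i ∈ Finset.univ, 2 * min (y t i) 0 * ∑ j, a t i j * (y t j - y t i) ≤
        ∑ j, (min (y t j) 0) ^ 2 := by
      intro i _
      rw [Finset.mul_sum]
      apply Finset.sum_le_sum
      intro j _
      have h1 : min (y t i) 0 ≤ 0 := min_le_right _ _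
      have h2 : min (y t j) 0 ≤ y t j := min_le_left _ _
      have h3 : min (y t i) 0 * y t i = (min (y t i) 0) ^ 2 := by
        rcases le_total (y t i) 0 with hu | hu <;> simp [hu, sq]
      have h4 : 2 * (min (y t i) 0 * (y t j - y t i)) ≤ (min (y t j) 0) ^ 2 := by
        nlinarith [sq_nonneg (min (y t i) 0 - min (y t j) 0), sq_nonneg (min (y t i) 0)]
      have h5 := ha0 t ht i j
      have h6 := haj t ht i j
      nlinarith [sq_nonneg (min (y t j) 0), mul_le_mul_of_nonneg_left h4 h5]
    refine (Finset.sum_le_sum this).trans ?_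
    simp
  have hg := gronwall_after hV hb ht
  have hz : ∑ i, (min (y s i) 0) ^ 2 = 0 := by
    apply Finset.sum_eq_zero
    intro i _
    simp [h0 i]
  simp only [hz, zero_mul] at hg
  have hle : ∑ i, (min (y t i) 0) ^ 2 ≤ 0 := by
    by_contra hcon
    push Not at hcon
    exact absurd hg (not_le.2 (mul_pos hcon (Real.exp_pos _)))
  have hi := Finset.single_le_sum (f := fun i => (min (y t i) 0) ^ 2) (fun j _ => sq_nonneg _)
      (Finset.mem_univ i)
  have : min (y t i) 0 = 0 := by
    have : (min (y t i) 0) ^ 2 = 0 := le_antisymm (hi.trans hle) (sq_nonneg _)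
    exact pow_eq_zero_iff (two_ne_zero) |>.1 this
  exact min_eq_right_iff.1 this

/-- One step of influence along an edge. -/
lemma averaging_step {N : ℕ} {y : ℝ → Fin N → ℝ} {a : ℝ → Fin N → Fin N → ℝ} {s η : ℝ}
    (ha0 : ∀ t, s ≤ t → ∀ i j, 0 ≤ a t i j) (ha1 : ∀ t, s ≤ t → ∀ i, ∑ j, a t i j ≤ 1)
    (hy : ∀ i t, s ≤ t → HasDerivAt (fun u => y u i) (∑ j, a t i j * (y t j - y t i)) t)
    (h0 : ∀ i, 0 ≤ y s i) (hη : 0 ≤ η) (i j : Fin N) (hij : ∀ t, s ≤ t → η ≤ a t i j) :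
    η * Real.exp (-1) * y s j ≤ y (s + 1) i := by
  have hpos : ∀ t, s ≤ t → ∀ i, 0 ≤ y t i := fun t ht i => averaging_nonneg ha0 ha1 hy h0 ht i
  have hlow : ∀ t, s ≤ t → ∀ i j, a t i j * y t j ≤
      y t i + ∑ j, a t i j * (y t j - y t i) := by
    intro t ht i j
    have h1 : ∑ j, a t i j * (y t j - y t i) = ∑ j, a t i j * y t j - (∑ j, a t i j) * y t i := by
      rw [Finset.sum_mul, ← Finset.sum_sub_distrib]
      exact Finset.sum_congr rfl fun j _ => by ring
    have h2 := Finset.single_le_sum (f := fun j => a t i j * y t j)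
      (fun j _ => mul_nonneg (ha0 t ht i j) (hpos t ht j)) (Finset.mem_univ j)
    have h3 := mul_le_mul_of_nonneg_right (ha1 t ht i) (hpos t ht i)
    linarith
  have hd : ∀ i t, s ≤ t → HasDerivAt (fun u => Real.exp u * y u i)
      (Real.exp t * (y t i + ∑ j, a t i j * (y t j - y t i))) t := by
    intro i t ht
    refine HasDerivAt.congr_deriv ((Real.hasDerivAt_exp t).mul (hy i t ht)) ?_
    ring
  have hmono : ∀ t, s ≤ t → Real.exp s * y s j ≤ Real.exp t * y t j := by
    intro t ht
    have := le_of_deriv_nonpos_after (fun t ht => (hd j t ht).neg) (fun t ht => by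
      have h1 := hlow t ht j j
      have h2 := mul_nonneg (ha0 t ht j j) (hpos t ht j)
      have h3 := mul_nonneg (Real.exp_pos t).le (h2.trans h1)
      linarith) le_rfl ht
    simp only [Pi.neg_apply] at this
    linarith
  have hF : ∀ t, s ≤ t → HasDerivAt
      (fun u => (η * (Real.exp s * y s j)) * u - Real.exp u * y u i)
      ((η * (Real.exp s * y s j)) * 1 -
        (Real.exp t * (y t i + ∑ j, a t i j * (y t j - y t i)))) t := fun t ht =>
    ((hasDerivAt_id t).const_mul _).sub (hd i t ht)
  have hfin := le_of_deriv_nonpos_after hF (fun t ht => by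
    have h1 := hlow t ht i j
    have h2 := mul_le_mul_of_nonneg_left h1 (Real.exp_pos t).le
    have h3 := mul_le_mul_of_nonneg_left (hmono t ht) hη
    have h4 := mul_le_mul_of_nonneg_right (hij t ht)
      (mul_nonneg (Real.exp_pos t).le (hpos t ht j))
    nlinarith) le_rfl (show s ≤ s + 1 by linarith)
  have h5 := mul_nonneg (Real.exp_pos s).le (h0 i)
  have h6 : η * (Real.exp s * y s j) ≤ Real.exp (s + 1) * y (s + 1) i := by
    nlinarith
  have h7 : Real.exp s * (η * y s j) ≤ Real.exp s * (Real.exp 1 * y (s + 1) i) := by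
    rw [Real.exp_add] at h6
    linarith
  have h8 := le_of_mul_le_mul_left h7 (Real.exp_pos s)
  have h9 := mul_le_mul_of_nonneg_left h8 (Real.exp_pos (-1)).le
  have h10 : Real.exp (-1) * Real.exp 1 = 1 := by rw [← Real.exp_add]; simp
  calc η * Real.exp (-1) * y s j = Real.exp (-1) * (η * y s j) := by ring
    _ ≤ _ := h9
    _ = _ := by rw [← mul_assoc, h10, one_mul]

lemma averaging_path {N : ℕ} {y : ℝ → Fin N → ℝ} {a : ℝ → Fin N → Fin N → ℝ} {s η : ℝ}
    (ha0 : ∀ t, s ≤ t → ∀ i j, 0 ≤ a t i j) (ha1 : ∀ t, s ≤ t → ∀ i, ∑ j, a t i j ≤ 1)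
    (hy : ∀ i t, s ≤ t → HasDerivAt (fun u => y u i) (∑ j, a t i j * (y t j - y t i)) t)
    (h0 : ∀ i, 0 ≤ y s i) (hη : 0 ≤ η) (n : ℕ) (p : ℕ → Fin N)
    (hp : ∀ k < n, ∀ t, s ≤ t → η ≤ a t (p k) (p (k + 1))) :
    (η * Real.exp (-1)) ^ n * y s (p n) ≤ y (s + n) (p 0) := by
  have : ∀ k ≤ n, (η * Real.exp (-1)) ^ k * y s (p n) ≤ y (s + k) (p (n - k)) := by
    intro k
    induction k with
    | zero => intro _; simp
    | succ k ih =>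
      intro hk
      have ih := ih (by omega)
      have hsk : s ≤ s + k := by simp
      have hst := averaging_step (s := s + k) (fun t ht => ha0 t (hsk.trans ht))
        (fun t ht => ha1 t (hsk.trans ht)) (fun i t ht => hy i t (hsk.trans ht))
        (fun i => averaging_nonneg ha0 ha1 hy h0 hsk i) hη (p (n - (k + 1))) (p (n - k))
        (fun t ht => by
          have := hp (n - (k + 1)) (by omega) t (hsk.trans ht)
          rwa [show n - (k + 1) + 1 = n - k by omega] at this)
      have hκ : 0 ≤ η * Real.exp (-1) := mul_nonneg hη (Real.exp_pos _).le
      push_cast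
      rw [← add_assoc]
      refine le_trans ?_ hst
      rw [pow_succ']
      nlinarith [mul_le_mul_of_nonneg_left ih hκ]
  simpa using this n le_rfl

lemma averaging_upper {N : ℕ} {x : ℝ → Fin N → ℝ} {a : ℝ → Fin N → Fin N → ℝ} {s U : ℝ}
    (ha0 : ∀ t, s ≤ t → ∀ i j, 0 ≤ a t i j) (ha1 : ∀ t, s ≤ t → ∀ i, ∑ j, a t i j ≤ 1)
    (hx : ∀ i t, s ≤ t → HasDerivAt (fun u => x u i) (∑ j, a t i j * (x t j - x t i)) t)
    (h0 : ∀ i, x s i ≤ U) {t : ℝ} (ht : s ≤ t) (i : Fin N) : x t i ≤ U := by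
  have := averaging_nonneg (y := fun t i => U - x t i) ha0 ha1 (fun i t ht => by
    refine HasDerivAt.congr_deriv ((hx i t ht).const_sub U) ?_
    rw [← Finset.sum_neg_distrib]
    exact Finset.sum_congr rfl fun j _ => by ring) (fun i => sub_nonneg.2 (h0 i)) ht i
  simpa using this

lemma averaging_lower {N : ℕ} {x : ℝ → Fin N → ℝ} {a : ℝ → Fin N → Fin N → ℝ} {s U : ℝ}
    (ha0 : ∀ t, s ≤ t → ∀ i j, 0 ≤ a t i j) (ha1 : ∀ t, s ≤ t → ∀ i, ∑ j, a t i j ≤ 1)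
    (hx : ∀ i t, s ≤ t → HasDerivAt (fun u => x u i) (∑ j, a t i j * (x t j - x t i)) t)
    (h0 : ∀ i, U ≤ x s i) {t : ℝ} (ht : s ≤ t) (i : Fin N) : U ≤ x t i := by
  have := averaging_nonneg (y := fun t i => x t i - U) ha0 ha1 (fun i t ht => by
    refine HasDerivAt.congr_deriv ((hx i t ht).sub_const U) ?_
    exact Finset.sum_congr rfl fun j _ => by ring) (fun i => sub_nonneg.2 (h0 i)) ht i
  simpa using this

lemma averaging_consensus {N : ℕ} (hN : 1 ≤ N) {x : ℝ → Fin N → ℝ}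
    {a : ℝ → Fin N → Fin N → ℝ} {η : ℝ}
    (ha0 : ∀ t, 0 ≤ t → ∀ i j, 0 ≤ a t i j) (ha1 : ∀ t, 0 ≤ t → ∀ i, ∑ j, a t i j ≤ 1)
    (hx : ∀ i t, 0 ≤ t → HasDerivAt (fun u => x u i) (∑ j, a t i j * (x t j - x t i)) t)
    (hη : 0 < η) (R : Fin N → Fin N → Prop) (hR : ∀ i, R i i)
    (hRa : ∀ i j, R i j → ∀ t, 0 ≤ t → η ≤ a t i j)
    (hconn : ∀ i j : Fin N, ∃ (m : ℕ) (p : ℕ → Fin N),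
      p 0 = i ∧ p m = j ∧ ∀ k < m, R (p k) (p (k + 1)))
    (hx0 : ∀ i, x 0 i ∈ Set.Icc (-1:ℝ) 1) :
    Tendsto (fun t => ⨆ i, ⨆ j, |x t j - x t i|) atTop (𝓝 0) := by
  have : Nonempty (Fin N) := ⟨⟨0, hN⟩⟩
  choose m p hp0 hpm hpR using hconn
  obtain ⟨K, hK⟩ : ∃ K : ℕ, ∀ i j, m i j ≤ K := by
    refine ⟨∑ i, ∑ j, m i j, fun i j => ?_⟩
    exact (Finset.single_le_sum (f := fun j => m i j) (fun j _ => Nat.zero_le _)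
      (Finset.mem_univ j)).trans (Finset.single_le_sum (f := fun i => ∑ j, m i j)
        (fun j _ => Nat.zero_le _) (Finset.mem_univ i))
  set γ : ℝ := (η * Real.exp (-1)) ^ K with hγ
  have hγ0 : 0 < γ := pow_pos (mul_pos hη (Real.exp_pos _)) _
  have hγ1 : γ ≤ 1 := by
    apply pow_le_one₀ (mul_pos hη (Real.exp_pos _)).le
    let i0 : Fin N := ⟨0, hN⟩
    have h1 := hRa i0 i0 (hR i0) 0 le_rfl
    have h2 := (Finset.single_le_sum (f := fun j => a 0 i0 j) (fun j _ => ha0 0 le_rfl i0 j)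
      (Finset.mem_univ i0)).trans (ha1 0 le_rfl i0)
    have h3 : Real.exp (-1) ≤ 1 := Real.exp_le_one_iff.2 (by norm_num)
    exact mul_le_one₀ (h1.trans h2) (Real.exp_pos _).le h3
  -- contraction on a window of length `K`
  have hcontr : ∀ s, 0 ≤ s → ∀ d, (∀ i j, x s i - x s j ≤ d) →
      ∀ t, s + K ≤ t → ∀ i j, x t i - x t j ≤ (1 - γ) * d := by
    intro s hs d hd t ht i j
    obtain ⟨iM, hM⟩ := Finite.exists_max (x s)
    obtain ⟨im, hm⟩ := Finite.exists_min (x s)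
    have hsK : s ≤ s + K := by simp
    have up : ∀ l, x (s + K) l ≤ x s iM - γ * (x s iM - x s im) := by
      intro l
      have := averaging_path (y := fun t i => x s iM - x t i) (s := s)
        (fun t ht => ha0 t (hs.trans ht)) (fun t ht => ha1 t (hs.trans ht))
        (fun i t ht => by
          refine HasDerivAt.congr_deriv ((hx i t (hs.trans ht)).const_sub (x s iM)) ?_
          rw [← Finset.sum_neg_distrib]
          exact Finset.sum_congr rfl fun j _ => by ring)
        (fun i => sub_nonneg.2 (hM i)) hη.le K (fun k => p l im (min k (m l im)))
        (fun k hk t ht => by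
          apply hRa _ _ _ _ (hs.trans ht)
          rcases lt_or_ge k (m l im) with h | h
          · rw [min_eq_left h.le, min_eq_left (show k + 1 ≤ m l im by omega)]
            exact hpR l im k h
          · rw [min_eq_right h, min_eq_right (show m l im ≤ k + 1 by omega)]
            exact hR _)
      simp only [min_eq_right (hK l im), Nat.zero_min, hp0, hpm] at this
      linarith
    have hs0 : 0 ≤ s + K := hs.trans hsK
    have h1 := averaging_upper (fun t ht => ha0 t (hs0.trans ht)) (fun t ht => ha1 t (hs0.trans ht))
        (fun i t ht => hx i t (hs0.trans ht)) up ht i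
    have h2 := averaging_lower (fun t ht => ha0 t (hs.trans ht)) (fun t ht => ha1 t (hs.trans ht))
        (fun i t ht => hx i t (hs.trans ht)) hm (hsK.trans ht) j
    have h3 := hd iM im
    nlinarith
  have hiter : ∀ n : ℕ, ∀ t, (n : ℝ) * K ≤ t → ∀ i j, x t i - x t j ≤ (1 - γ) ^ n * 2 := by
    intro n
    induction n with
    | zero =>
      intro t ht i j
      simp only [Nat.cast_zero, zero_mul] at ht
      have h1 := averaging_upper ha0 ha1 hx (fun i => (hx0 i).2) ht i
      have h2 := averaging_lower ha0 ha1 hx (fun i => (hx0 i).1) ht j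
      simp only [pow_zero]
      linarith
    | succ n ih =>
      intro t ht
      have := hcontr ((n : ℝ) * K) (by positivity) _ (ih _ le_rfl) t (by
        push_cast at ht
        linarith)
      intro i j
      have := this i j
      rw [pow_succ']
      linarith
  have hlim : Tendsto (fun n : ℕ => (1 - γ) ^ n * 2) atTop (𝓝 0) := by
    have := (tendsto_pow_atTop_nhds_zero_of_lt_one (r := 1 - γ) (by linarith)
      (by linarith)).mul_const 2
    simpa using this
  rw [Metric.tendsto_atTop]
  intro ε hε
  obtain ⟨n, hn⟩ := (hlim.eventually (gt_mem_nhds hε)).exists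
  refine ⟨(n : ℝ) * K, fun t ht => ?_⟩
  have hb : ⨆ i, ⨆ j, |x t j - x t i| ≤ (1 - γ) ^ n * 2 := by
    refine ciSup_le fun i => ciSup_le fun j => abs_le.2 ⟨?_, hiter n t ht j i⟩
    have := hiter n t ht i j
    linarith
  have hnn : 0 ≤ ⨆ i, ⨆ j, |x t j - x t i| :=
    Real.iSup_nonneg fun i => Real.iSup_nonneg fun j => abs_nonneg _
  rw [Real.dist_eq, sub_zero, abs_of_nonneg hnn]
  exact hb.trans_lt hn

lemma exists_pos_lower {N : ℕ} (v : Fin N → Fin N → ℝ) :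
    ∃ μ : ℝ, 0 < μ ∧ ∀ i j, 0 < v i j → μ ≤ v i j := by
  by_cases h : Nonempty (Fin N × Fin N)
  · obtain ⟨q, hq⟩ := Finite.exists_min
      (fun q : Fin N × Fin N => if 0 < v q.1 q.2 then v q.1 q.2 else 1)
    refine ⟨if 0 < v q.1 q.2 then v q.1 q.2 else 1, ?_, fun i j hij => ?_⟩
    · split_ifs with h
      · exact h
      · exact one_pos
    · have := hq (i, j)
      simp only [hij, if_true] at this
      exact this
  · exact ⟨1, one_pos, fun i j _ => absurd ⟨(i, j)⟩ h⟩

theorem stmt5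
    (N : ℕ) (hN : 1 ≤ N)
    (x : ℝ → Fin N → ℝ) (w : ℝ → Fin N → Fin N → ℝ)
    (φ : ℝ → ℝ)
    (hφ_lip : ∃ L : NNReal, LipschitzWith L φ)
    (hφ_range : ∀ r : ℝ, φ r ∈ Set.Icc (0:ℝ) 1)
    (hφ_even : ∀ r : ℝ, φ (-r) = φ r)
    (hw01 : ∀ t : ℝ, 0 ≤ t → ∀ i j, w t i j ∈ Set.Icc (0:ℝ) 1)
    (hwdiag : ∀ t : ℝ, 0 ≤ t → ∀ i, w t i i = 1)
    (hx0 : ∀ i, x 0 i ∈ Set.Icc (-1:ℝ) 1)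
    (hx : ∀ i, ∀ t : ℝ, 0 ≤ t →
      HasDerivAt (fun s => x s i)
        ((1 / ∑ j, w t i j) * ∑ j, w t i j * φ (x t j - x t i) * (x t j - x t i)) t)
    (hw : ∀ i j, i ≠ j → ∀ t : ℝ, 0 ≤ t →
      HasDerivAt (fun s => w s i j)
        (w t i j * (1 - w t i j) * (2 * φ (x t j - x t i) - 1)) t)
    (c : ℝ) (hc : (1:ℝ)/2 ≤ c)
    (hφc : ∀ r ∈ Set.Icc (-2:ℝ) 2, c < φ r)
    (hconn : ∀ i j : Fin N, ∃ (m : ℕ) (p : ℕ → Fin N),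
      p 0 = i ∧ p m = j ∧ ∀ k < m, 0 < w 0 (p k) (p (k + 1))) :
    Tendsto (fun t => ⨆ i, ⨆ j, |x t j - x t i|) atTop (𝓝 0) ∧
    ∀ i j, i ≠ j →
      (0 < w 0 i j → Tendsto (fun t => w t i j) atTop (𝓝 1)) ∧
      (w 0 i j = 0 → ∀ t : ℝ, 0 ≤ t → w t i j = 0) := by
  
  have hk1 : ∀ t, 0 ≤ t → ∀ i, 1 ≤ ∑ j, w t i j := by
    intro t ht i
    rw [← hwdiag t ht i]
    exact Finset.single_le_sum (f := fun j => w t i j) (fun j _ => (hw01 t ht i j).1)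
      (Finset.mem_univ i)
  have hkN : ∀ t, 0 ≤ t → ∀ i, ∑ j, w t i j ≤ N := by
    intro t ht i
    refine (Finset.sum_le_sum fun j _ => (hw01 t ht i j).2).trans ?_
    simp
  set a : ℝ → Fin N → Fin N → ℝ :=
    fun t i j => w t i j * φ (x t j - x t i) / ∑ j, w t i j with ha
  have ha0 : ∀ t, 0 ≤ t → ∀ i j, 0 ≤ a t i j := fun t ht i j =>
    div_nonneg (mul_nonneg (hw01 t ht i j).1 (hφ_range _).1) (by linarith [hk1 t ht i])
  have ha1 : ∀ t, 0 ≤ t → ∀ i, ∑ j, a t i j ≤ 1 := by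
    intro t ht i
    simp only [ha]
    rw [← Finset.sum_div]
    apply div_le_one_of_le₀ _ (by linarith [hk1 t ht i])
    exact Finset.sum_le_sum fun j _ => mul_le_of_le_one_right (hw01 t ht i j).1 (hφ_range _).2
  have hxa : ∀ i t, 0 ≤ t → HasDerivAt (fun u => x u i) (∑ j, a t i j * (x t j - x t i)) t := by
    intro i t ht
    convert hx i t ht using 1
    rw [Finset.mul_sum]
    exact Finset.sum_congr rfl fun j _ => by simp only [ha]; ring
  have hbd : ∀ t, 0 ≤ t → ∀ i j, x t j - x t i ∈ Set.Icc (-2:ℝ) 2 := by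
    intro t ht i j
    have h1 := fun i => averaging_upper ha0 ha1 hxa (fun i => (hx0 i).2) ht i
    have h2 := fun i => averaging_lower ha0 ha1 hxa (fun i => (hx0 i).1) ht i
    constructor <;> linarith [h1 i, h1 j, h2 i, h2 j]
  obtain ⟨L, hL⟩ := hφ_lip
  obtain ⟨r, hr, hrmin⟩ := isCompact_Icc.exists_isMinOn
    (Set.nonempty_Icc.2 (show (-2:ℝ) ≤ 2 by norm_num)) hL.continuous.continuousOn
  obtain ⟨δ, hδ, hδφ⟩ : ∃ δ : ℝ, 0 < δ ∧ ∀ t, 0 ≤ t → ∀ i j,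
      δ ≤ 2 * φ (x t j - x t i) - 1 := by
    refine ⟨2 * φ r - 1, by linarith [hφc r hr], fun t ht i j => ?_⟩
    have : φ r ≤ φ (x t j - x t i) := hrmin (hbd t ht i j)
    linarith
  have hwmono : ∀ i j, ∀ t, 0 ≤ t → w 0 i j ≤ w t i j := by
    intro i j t ht
    by_cases hij : i = j
    · subst hij
      rw [hwdiag t ht, hwdiag 0 le_rfl]
    · have := le_of_deriv_nonpos_after (fun t ht => (hw i j hij t ht).neg) (fun t ht => by
        have h1 := hw01 t ht i j
        have h2 := mul_nonneg (mul_nonneg h1.1 (sub_nonneg.2 h1.2))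
          (hδ.le.trans (hδφ t ht i j))
        linarith) le_rfl ht
      simp only [Pi.neg_apply] at this
      linarith
  have hNpos : (0:ℝ) < N := by exact_mod_cast hN
  refine ⟨?_, fun i j hij => ⟨fun hpos => ?_, fun hz t ht => ?_⟩⟩
  · obtain ⟨μ, hμ, hμw⟩ := exists_pos_lower (w 0)
    refine averaging_consensus hN (η := μ * (1 / 2) / N) ha0 ha1 hxa (by positivity)
      (fun i j => 0 < w 0 i j) (fun i => by rw [hwdiag 0 le_rfl]; exact one_pos) ?_ hconn hx0
    intro i j hij t ht
    have h1 := (hμw i j hij).trans (hwmono i j t ht)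
    have h2 : 1 / 2 ≤ φ (x t j - x t i) := by linarith [hδφ t ht i j]
    have h3 : 0 < ∑ j, w t i j := by linarith [hk1 t ht i]
    simp only [ha]
    apply div_le_div₀ (mul_nonneg (hw01 t ht i j).1 (hφ_range _).1) _ h3 (hkN t ht i)
    exact mul_le_mul h1 h2 (by norm_num) (hw01 t ht i j).1
  · have hg : ∀ t, 0 ≤ t → (1 - w t i j) ≤ (1 - w 0 i j) * Real.exp (-(δ * w 0 i j) * t) := by
      intro t ht
      have := gronwall_after (c := -(δ * w 0 i j)) (s := 0)
        (fun t ht => (hw i j hij t ht).const_sub 1) (fun t ht => by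
          have h1 := hw01 t ht i j
          have h2 := hwmono i j t ht
          have h3 := hδφ t ht i j
          have h4 : δ * w 0 i j ≤ (2 * φ (x t j - x t i) - 1) * w t i j :=
            mul_le_mul h3 h2 hpos.le (hδ.le.trans h3)
          nlinarith [mul_le_mul_of_nonneg_right h4 (sub_nonneg.2 h1.2)]) ht
      simp only [neg_neg, mul_zero, Real.exp_zero, mul_one] at this
      have h5 := mul_le_mul_of_nonneg_right this (Real.exp_pos (-(δ * w 0 i j) * t)).le
      rwa [mul_assoc, ← Real.exp_add, show δ * w 0 i j * t + -(δ * w 0 i j) * t = 0 by ring,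
        Real.exp_zero, mul_one] at h5
    have hlim : Tendsto (fun t => 1 - (1 - w 0 i j) * Real.exp (-(δ * w 0 i j) * t))
        atTop (𝓝 1) := by
      have h1 : Tendsto (fun t : ℝ => -(δ * w 0 i j) * t) atTop atBot :=
        tendsto_id.const_mul_atTop_of_neg (by linarith [mul_pos hδ hpos])
      have h2 := ((Real.tendsto_exp_atBot.comp h1).const_mul (1 - w 0 i j)).const_sub 1
      simpa using h2
    refine tendsto_of_tendsto_of_tendsto_of_le_of_le' hlim tendsto_const_nhds ?_ ?_
    · filter_upwards [eventually_ge_atTop 0] with t ht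
      linarith [hg t ht]
    · filter_upwards [eventually_ge_atTop 0] with t ht
      exact (hw01 t ht i j).2
  · have := gronwall_after (c := 1) (s := 0) (fun t ht => hw i j hij t ht) (fun t ht => by
      have h1 := hw01 t ht i j
      have h2 := hφ_range (x t j - x t i)
      have h3 : (1 - w t i j) * (2 * φ (x t j - x t i) - 1) ≤ 1 := by
        nlinarith [h1.1, h1.2, h2.1, h2.2, mul_nonneg (sub_nonneg.2 h1.2) (sub_nonneg.2 h2.2)]
      nlinarith [mul_le_mul_of_nonneg_left h3 h1.1]) ht
    rw [hz, zero_mul] at this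
    refine le_antisymm ?_ (hw01 t ht i j).1
    by_contra hcon
    push Not at hcon
    exact absurd this (not_le.2 (mul_pos hcon (Real.exp_pos _)))
end

section
/- Suppose φ is a smooth bounded-confidence interaction function with radius R ∈ (0,2), normalised so that φ(0) = 1, and the system follows memory weight dynamics. Then for every pair of individuals i, j, either x_j(t) − x_i(t) → 0 and w_{ij}(t) → 1 as t → ∞, or φ(x_j(t) − x_i(t)) → 0 and w_{ij}(t) → 0 as t → ∞. -/
open Filter Topology MeasureTheory

namespace Aux8

lemma deriv_nonneg_of_left_max {f : ℝ → ℝ} {f' t T : ℝ} (ht : 0 < t) (htT : t ≤ T)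
    (hd : HasDerivAt f f' t) (hm : ∀ s ∈ Set.Icc 0 T, f s ≤ f t) : 0 ≤ f' := by
  have h1 : Tendsto (slope f t) (𝓝[<] t) (𝓝 f') :=
    (hasDerivAt_iff_tendsto_slope.1 hd).mono_left
      (nhdsWithin_mono _ (fun y hy => ne_of_lt hy))
  refine ge_of_tendsto h1 ?_
  filter_upwards [Ioo_mem_nhdsLT ht] with s hs
  rw [slope_def_field]
  apply div_nonneg_of_nonpos
  · linarith [hm s ⟨hs.1.le, hs.2.le.trans htT⟩]
  · linarith [hs.2]

lemma maxp {ι : Type*} [Finite ι] (h h' : ι → ℝ → ℝ)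
    (hd : ∀ i t, 0 ≤ t → HasDerivAt (h i) (h' i t) t)
    (hmax : ∀ i t, 0 ≤ t → (∀ j, h j t ≤ h i t) → h' i t ≤ 0) (B : ℝ)
    (h0 : ∀ i, h i 0 ≤ B) : ∀ i t, 0 ≤ t → h i t ≤ B := by
  intro i T hT
  have key : ∀ ε : ℝ, 0 < ε → h i T ≤ B + ε * T := by
    intro ε hε
    have hd2 : ∀ j t, 0 ≤ t → HasDerivAt (fun s => h j s - ε * s) (h' j t - ε) t := by
      intro j t ht
      have := (hd j t ht).sub ((hasDerivAt_id t).const_mul ε)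
      exact this.congr_deriv (by simp)
    have hex : ∀ j, ∃ t ∈ Set.Icc 0 T, ∀ s ∈ Set.Icc 0 T, h j s - ε * s ≤ h j t - ε * t := by
      intro j
      have hc : ContinuousOn (fun s => h j s - ε * s) (Set.Icc 0 T) :=
        fun s hs => (hd2 j s hs.1).continuousAt.continuousWithinAt
      obtain ⟨t, ht, hm⟩ := isCompact_Icc.exists_isMaxOn ⟨0, by simp [hT]⟩ hc
      exact ⟨t, ht, fun s hs => hm hs⟩
    choose τ hτ hτm using hex
    have : Nonempty ι := ⟨i⟩
    obtain ⟨j, hj⟩ := Finite.exists_max (fun j => h j (τ j) - ε * τ j)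
    have hall : ∀ k, ∀ s ∈ Set.Icc 0 T, h k s - ε * s ≤ h j (τ j) - ε * τ j :=
      fun k s hs => (hτm k s hs).trans (hj k)
    have hiT := hall i T ⟨hT, le_rfl⟩
    rcases (hτ j).1.eq_or_lt with h00 | hpos
    · rw [← h00] at hiT
      linarith [h0 j]
    · exfalso
      have h1 := deriv_nonneg_of_left_max hpos (hτ j).2 (hd2 j _ hpos.le)
        (fun s hs => hall j s hs)
      have h2 := hmax j (τ j) hpos.le (fun k => by linarith [hall k _ (hτ j)])
      linarith
  by_contra! hcon
  have := key ((h i T - B) / (2 * (T + 1))) (by apply div_pos <;> linarith)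
  have h2 : (h i T - B) / (2 * (T + 1)) * T ≤ (h i T - B) / 2 := by
    rw [div_mul_eq_mul_div, div_le_div_iff₀ (by linarith) (by norm_num)]
    nlinarith
  linarith

lemma mono_of_deriv {f f' : ℝ → ℝ} (T : ℝ) (hd : ∀ t, T ≤ t → HasDerivAt f (f' t) t)
    (hn : ∀ t, T ≤ t → 0 ≤ f' t) : ∀ s t, T ≤ s → s ≤ t → f s ≤ f t := by
  have : MonotoneOn f (Set.Ici T) := by
    apply monotoneOn_of_deriv_nonneg (convex_Ici T)
    · exact fun s hs => (hd s hs).continuousAt.continuousWithinAt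
    · intro s hs
      rw [interior_Ici] at hs
      exact (hd s (le_of_lt hs)).differentiableAt.differentiableWithinAt
    · intro s hs
      rw [interior_Ici] at hs
      rw [(hd s (le_of_lt hs)).deriv]
      exact hn s (le_of_lt hs)
  exact fun s t hs hst => this hs (Set.mem_Ici.2 (hs.trans hst)) hst

lemma conv_of_mono {f : ℝ → ℝ} (B : ℝ) (hm : ∀ s t, 0 ≤ s → s ≤ t → f s ≤ f t)
    (hb : ∀ t, 0 ≤ t → f t ≤ B) : ∃ l, Tendsto f atTop (𝓝 l) := by
  have hmono : Monotone (fun t => f (max t 0)) := fun s t hst =>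
    hm _ _ (le_max_right _ _) (max_le_max_right _ hst)
  have hbdd : BddAbove (Set.range (fun t => f (max t 0))) :=
    ⟨B, by rintro _ ⟨t, rfl⟩; exact hb _ (le_max_right _ _)⟩
  refine ⟨_, (tendsto_atTop_ciSup hmono hbdd).congr' ?_⟩
  filter_upwards [eventually_ge_atTop 0] with t ht
  simp [max_eq_left ht]

/-- if g' = D → L and g is bounded above, then L ≤ 0. -/
lemma lim_nonpos {g D : ℝ → ℝ} {L B : ℝ} (hd : ∀ t, 0 ≤ t → HasDerivAt g (D t) t)
    (hb : ∀ t, 0 ≤ t → g t ≤ B) (hL : Tendsto D atTop (𝓝 L)) : L ≤ 0 := by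
  by_contra! hpos
  obtain ⟨T, hT⟩ := eventually_atTop.1 (hL.eventually (lt_mem_nhds (show L / 2 < L by linarith)))
  set T' := max T 0
  have hm := mono_of_deriv (f := fun t => g t - L / 2 * t) (f' := fun t => D t - L / 2) T'
    (fun t ht => by
      have := (hd t ((le_max_right _ _).trans ht)).sub ((hasDerivAt_id t).const_mul (L / 2))
      exact this.congr_deriv (by simp))
    (fun t ht => by linarith [hT t ((le_max_left _ _).trans ht)])
  have hT0 : 0 ≤ T' := le_max_right _ _
  have hnn : 0 ≤ (B - g T' + 1) / (L / 2) := by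
    apply div_nonneg <;> linarith [hb T' hT0]
  have h1 := hm T' (T' + (B - g T' + 1) / (L / 2)) le_rfl (by linarith)
  have h2 := hb (T' + (B - g T' + 1) / (L / 2)) (by linarith)
  have h3 : L / 2 * ((B - g T' + 1) / (L / 2)) = B - g T' + 1 := by
    field_simp
  simp only [mul_add] at h1
  linarith

/-- upper half of relaxation -/
lemma relax_le {u F : ℝ → ℝ} {a ε : ℝ} (hε : 0 < ε)
    (hd : ∀ t, 0 ≤ t → HasDerivAt u (F t - u t) t) (hF : Tendsto F atTop (𝓝 a)) :
    ∀ᶠ t in atTop, u t < a + ε := by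
  obtain ⟨T, hT⟩ := eventually_atTop.1 (hF.eventually (gt_mem_nhds (show a < a + ε / 2 by linarith)))
  set T' := max T 0
  have hm := mono_of_deriv (f := fun t => Real.exp t * (a + ε / 2 - u t))
    (f' := fun t => Real.exp t * (a + ε / 2 - F t)) T'
    (fun t ht => by
      have := (Real.hasDerivAt_exp t).mul ((hd t ((le_max_right _ _).trans ht)).const_sub (a + ε / 2))
      refine this.congr_deriv ?_
      ring)
    (fun t ht => mul_nonneg (Real.exp_pos _).le
      (by linarith [hT t ((le_max_left _ _).trans ht)]))
  have hlim : Tendsto (fun t => Real.exp (-t) * (Real.exp T' * (a + ε / 2 - u T'))) atTop (𝓝 0) := by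
    have := (Real.tendsto_exp_neg_atTop_nhds_zero).mul_const (Real.exp T' * (a + ε / 2 - u T'))
    simpa using this
  filter_upwards [eventually_ge_atTop T', hlim.eventually (lt_mem_nhds (show -(ε/2) < 0 by linarith))]
    with t ht h2
  have h1 := mul_le_mul_of_nonneg_left (hm T' t le_rfl ht) (Real.exp_pos (-t)).le
  have h3 : Real.exp (-t) * (Real.exp t * (a + ε / 2 - u t)) = a + ε / 2 - u t := by
    rw [← mul_assoc, ← Real.exp_add]; simp
  linarith

lemma relax {u F : ℝ → ℝ} {a : ℝ}
    (hd : ∀ t, 0 ≤ t → HasDerivAt u (F t - u t) t) (hF : Tendsto F atTop (𝓝 a)) :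
    Tendsto u atTop (𝓝 a) := by
  rw [Metric.tendsto_nhds]
  intro ε hε
  have h1 := relax_le hε hd hF
  have h2 := relax_le (u := fun t => - u t) (F := fun t => - F t) (a := -a) hε
    (fun t ht => (hd t ht).neg.congr_deriv (by ring)) hF.neg
  filter_upwards [h1, h2] with t h1 h2
  rw [Real.dist_eq, abs_lt]
  constructor <;> linarith

/-- pair estimate -/
lemma pair_est (n ci cj wij wji ki kj e f r C : ℝ) (hn : 1 ≤ n)
    (hki : 1 ≤ ki) (hkin : ki ≤ n) (hkj : 1 ≤ kj)
    (hwij : 0 ≤ wij) (hwji : 0 ≤ wji) (he : 0 ≤ e)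
    (hji : wji ≤ wij + e) (hf : 0 ≤ f) (hf1 : f ≤ 1) (hr : 0 ≤ r) (hr2 : r ≤ 2)
    (hcj : 1 ≤ cj) (hcjC : cj ≤ C) (hc : 0 < r → 2 * n * cj ≤ ci) :
    ci * (1 / ki * (wij * f * (-r))) + cj * (1 / kj * (wji * f * r)) ≤
      -((wij * f * r + wji * f * r) / 2) + (2 * C + 1) * e := by
  rcases hr.eq_or_lt with h0 | hpos
  · subst h0; simp; nlinarith
  have hci := hc hpos
  have h1 : 2 * cj ≤ ci * (1 / ki) := by
    rw [mul_one_div, le_div_iff₀ (by linarith)]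
    nlinarith
  have h2 : cj * (1 / kj) ≤ cj := by
    rw [mul_one_div]; exact div_le_self (by linarith) hkj
  have hA : 0 ≤ f * r := by positivity
  have hA2 : f * r ≤ 2 := by nlinarith
  have e1 : 2 * cj * (wij * (f * r)) ≤ ci * (1 / ki) * (wij * (f * r)) :=
    mul_le_mul_of_nonneg_right h1 (by positivity)
  have e2 : cj * (1 / kj) * (wji * (f * r)) ≤ cj * (wji * (f * r)) :=
    mul_le_mul_of_nonneg_right h2 (by positivity)
  have e3 : wji * (f * r) ≤ (wij + e) * (f * r) := mul_le_mul_of_nonneg_right hji hA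
  have e4 : cj * (wji * (f * r)) ≤ cj * ((wij + e) * (f * r)) :=
    mul_le_mul_of_nonneg_left e3 (by linarith)
  have e5 : wij * (f * r) ≤ cj * (wij * (f * r)) := by
    have : 0 ≤ wij * (f * r) := by positivity
    nlinarith
  have e6 : e * (f * r) ≤ 2 * e := by nlinarith
  have e7 : cj * (e * (f * r)) ≤ C * (2 * e) := by
    apply mul_le_mul hcjC e6 (by positivity) (by linarith)
  nlinarith

lemma swap_est {N : ℕ} (c : Fin N → ℝ) (y : Fin N → ℝ) (σ : Equiv.Perm (Fin N))
    (i j : Fin N) (hij : i ≠ j)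
    (hm : ∑ k, c ((σ * Equiv.swap i j) k) * y k ≤ ∑ k, c (σ k) * y k) :
    0 ≤ (c (σ i) - c (σ j)) * (y i - y j) := by
  have h : ∑ k, (c (σ k) * y k - c ((σ * Equiv.swap i j) k) * y k) =
      (c (σ i) * y i - c ((σ * Equiv.swap i j) i) * y i) +
      (c (σ j) * y j - c ((σ * Equiv.swap i j) j) * y j) := by
    apply Fintype.sum_eq_add i j hij
    rintro k ⟨h1, h2⟩
    simp [Equiv.swap_apply_of_ne_of_ne h1 h2]
  rw [Finset.sum_sub_distrib] at h
  simp at h hm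
  nlinarith

end Aux8

theorem stmt8
    (N : ℕ) (hN : 1 ≤ N)
    (x : ℝ → Fin N → ℝ) (w : ℝ → Fin N → Fin N → ℝ)
    (φ : ℝ → ℝ)
    (hφ_lip : ∃ L : NNReal, LipschitzWith L φ)
    (hφ_range : ∀ r : ℝ, φ r ∈ Set.Icc (0:ℝ) 1)
    (hφ_even : ∀ r : ℝ, φ (-r) = φ r)
    (hw01 : ∀ t : ℝ, 0 ≤ t → ∀ i j, w t i j ∈ Set.Icc (0:ℝ) 1)
    (hwdiag : ∀ t : ℝ, 0 ≤ t → ∀ i, w t i i = 1)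
    (hx0 : ∀ i, x 0 i ∈ Set.Icc (-1:ℝ) 1)
    (hx : ∀ i, ∀ t : ℝ, 0 ≤ t →
      HasDerivAt (fun s => x s i)
        ((1 / ∑ j, w t i j) * ∑ j, w t i j * φ (x t j - x t i) * (x t j - x t i)) t)
    (hw : ∀ i j, i ≠ j → ∀ t : ℝ, 0 ≤ t →
      HasDerivAt (fun s => w s i j) (φ (x t j - x t i) - w t i j) t)
    (R : ℝ) (hR : R ∈ Set.Ioo (0:ℝ) 2)
    (hφ_pos : ∀ r : ℝ, |r| < R → 0 < φ r)
    (hφ_zero : ∀ r : ℝ, R ≤ |r| → |r| ≤ 2 → φ r = 0)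
    (hφ0 : φ 0 = 1) :
    ∀ i j : Fin N,
      (Tendsto (fun t => x t j - x t i) atTop (𝓝 0) ∧
        Tendsto (fun t => w t i j) atTop (𝓝 1)) ∨
      (Tendsto (fun t => φ (x t j - x t i)) atTop (𝓝 0) ∧
        Tendsto (fun t => w t i j) atTop (𝓝 0)) := by
  classical
  have hw0 : ∀ t, 0 ≤ t → ∀ i j, 0 ≤ w t i j := fun t ht i j => (hw01 t ht i j).1
  have hk1 : ∀ t, 0 ≤ t → ∀ i, 1 ≤ ∑ j, w t i j := by
    intro t ht i
    rw [← hwdiag t ht i]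
    exact Finset.single_le_sum (f := fun j => w t i j) (fun j _ => hw0 t ht i j)
      (Finset.mem_univ i)
  have hkN : ∀ t, 0 ≤ t → ∀ i, ∑ j, w t i j ≤ (N : ℝ) := by
    intro t ht i
    calc ∑ j, w t i j ≤ ∑ _j : Fin N, (1 : ℝ) :=
          Finset.sum_le_sum (fun j _ => (hw01 t ht i j).2)
      _ = N := by simp
  -- bounds on opinions
  have hxle : ∀ i t, 0 ≤ t → x t i ≤ 1 := by
    refine Aux8.maxp (fun i t => x t i) _ hx ?_ 1 (fun i => (hx0 i).2)
    intro i t ht hm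
    apply mul_nonpos_of_nonneg_of_nonpos
    · exact one_div_nonneg.2 (by linarith [hk1 t ht i])
    · apply Finset.sum_nonpos
      intro j _
      apply mul_nonpos_of_nonneg_of_nonpos
      · exact mul_nonneg (hw0 t ht i j) (hφ_range _).1
      · linarith [hm j]
  have hxge : ∀ i t, 0 ≤ t → -x t i ≤ 1 := by
    refine Aux8.maxp (fun i t => -x t i) _ (fun i t ht => (hx i t ht).neg) ?_ 1
      (fun i => by linarith [(hx0 i).1])
    intro i t ht hm
    apply neg_nonpos.2
    apply mul_nonneg
    · exact one_div_nonneg.2 (by linarith [hk1 t ht i])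
    · apply Finset.sum_nonneg
      intro j _
      apply mul_nonneg
      · exact mul_nonneg (hw0 t ht i j) (hφ_range _).1
      · linarith [hm j]
  -- near symmetry of the weights
  have hsym : ∀ i j t, 0 ≤ t → w t j i ≤ w t i j + Real.exp (-t) := by
    intro i j t ht
    by_cases hij : i = j
    · subst hij; linarith [Real.exp_pos (-t)]
    have hm := Aux8.mono_of_deriv (f := fun t => Real.exp t * (w t i j - w t j i))
      (f' := fun _ => 0) 0
      (fun s hs => by
        have := (Real.hasDerivAt_exp s).mul ((hw i j hij s hs).sub (hw j i (Ne.symm hij) s hs))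
        refine this.congr_deriv ?_
        have he : φ (x s i - x s j) = φ (x s j - x s i) := by
          rw [← hφ_even]; congr 1; ring
        rw [he]
        simp only [Pi.sub_apply]
        ring) (fun _ _ => le_rfl) 0 t le_rfl ht
    simp only [Real.exp_zero, one_mul] at hm
    have h1 : -1 ≤ Real.exp t * (w t i j - w t j i) := by
      linarith [(hw01 0 le_rfl i j).1, (hw01 0 le_rfl j i).2]
    have h2 := mul_le_mul_of_nonneg_left h1 (Real.exp_pos (-t)).le
    rw [← mul_assoc, ← Real.exp_add] at h2
    simp at h2
    linarith
  -- continuity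
  obtain ⟨Lc, hLip⟩ := hφ_lip
  have hφc : Continuous φ := hLip.continuous
  have hmax0 : Continuous (fun s : ℝ => max s 0) := by fun_prop
  have hxc : ∀ i, Continuous (fun s : ℝ => x (max s 0) i) := by
    intro i
    rw [continuous_iff_continuousAt]
    intro s
    exact ContinuousAt.comp (g := fun s => x s i) (f := fun s => max s 0)
      (hx i _ (le_max_right _ _)).continuousAt hmax0.continuousAt
  have hwc : ∀ i j, Continuous (fun s : ℝ => w (max s 0) i j) := by
    intro i j
    by_cases hij : i = j
    · subst hij
      have : (fun s : ℝ => w (max s 0) i i) = fun _ => 1 := by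
        funext s; exact hwdiag _ (le_max_right _ _) i
      rw [this]; exact continuous_const
    rw [continuous_iff_continuousAt]
    intro s
    exact ContinuousAt.comp (g := fun s => w s i j) (f := fun s => max s 0)
      (hw i j hij _ (le_max_right _ _)).continuousAt hmax0.continuousAt
  -- dissipation
  set q : ℝ → Fin N → Fin N → ℝ :=
    fun t i j => w t i j * φ (x t j - x t i) * |x t j - x t i| with hq
  have hq0 : ∀ t, 0 ≤ t → ∀ i j, 0 ≤ q t i j := fun t ht i j =>
    mul_nonneg (mul_nonneg (hw0 t ht i j) (hφ_range _).1) (abs_nonneg _)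
  set D : ℝ → ℝ := fun t => ∑ i, ∑ j, q t i j with hD
  have hqD : ∀ t, 0 ≤ t → ∀ i j, q t i j ≤ D t := by
    intro t ht i j
    calc q t i j ≤ ∑ j, q t i j :=
          Finset.single_le_sum (f := fun j => q t i j) (fun j _ => hq0 t ht i j)
            (Finset.mem_univ j)
      _ ≤ D t := Finset.single_le_sum (f := fun i => ∑ j, q t i j)
            (fun i _ => Finset.sum_nonneg (fun j _ => hq0 t ht i j)) (Finset.mem_univ i)
  have hqsD : ∀ t, 0 ≤ t → ∀ i, ∑ j, q t i j ≤ D t := by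
    intro t ht i
    exact Finset.single_le_sum (f := fun i => ∑ j, q t i j)
            (fun i _ => Finset.sum_nonneg (fun j _ => hq0 t ht i j)) (Finset.mem_univ i)
  have hDc : Continuous (fun s : ℝ => D (max s 0)) := by
    simp only [hD, hq]
    refine continuous_finsetSum _ (fun i _ => continuous_finsetSum _ (fun j _ => ?_))
    exact ((hwc i j).mul (hφc.comp ((hxc j).sub (hxc i)))).mul ((hxc j).sub (hxc i)).abs
  set g : ℝ → ℝ := fun t => ∫ s in (0:ℝ)..t, D (max s 0) with hg
  have hgd : ∀ t, 0 ≤ t → HasDerivAt g (D t) t := by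
    intro t ht
    have := hDc.integral_hasStrictDerivAt 0 t
    have h2 := this.hasDerivAt
    simp only [max_eq_left ht] at h2
    exact h2
  have hg0 : g 0 = 0 := by simp [hg]
  -- Lyapunov functions
  have hN1 : (1 : ℝ) ≤ N := by exact_mod_cast hN
  set c : Fin N → ℝ := fun k => (2 * (N : ℝ)) ^ (k : ℕ) with hc
  set C : ℝ := (2 * (N : ℝ)) ^ N with hC
  have hc1 : ∀ k, 1 ≤ c k := fun k => one_le_pow₀ (by linarith)
  have hcC : ∀ k, c k ≤ C := fun k => pow_le_pow_right₀ (by linarith) k.2.le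
  have hclt : ∀ k l : Fin N, k < l → 2 * (N : ℝ) * c k ≤ c l := by
    intro k l hkl
    have : c l ≥ (2 * (N : ℝ)) ^ ((k : ℕ) + 1) :=
      pow_le_pow_right₀ (by linarith) hkl
    rw [pow_succ] at this
    linarith
  set p : ℝ → Equiv.Perm (Fin N) → Fin N → Fin N → ℝ := fun t σ i j =>
    c (σ i) * (1 / (∑ j, w t i j) * (w t i j * φ (x t j - x t i) * (x t j - x t i))) with hp
  have hVd : ∀ (σ : Equiv.Perm (Fin N)) t, 0 ≤ t →
      HasDerivAt (fun s => ∑ i, c (σ i) * x s i) (∑ i, ∑ j, p t σ i j) t := by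
    intro σ t ht
    have := HasDerivAt.fun_sum (u := Finset.univ)
      (fun i _ => (hx i t ht).const_mul (c (σ i)))
    refine this.congr_deriv ?_
    refine Finset.sum_congr rfl (fun i _ => ?_)
    simp only [hp]
    rw [Finset.mul_sum, Finset.mul_sum]
  have hpair : ∀ (σ : Equiv.Perm (Fin N)) t, 0 ≤ t →
      (∀ τ : Equiv.Perm (Fin N), ∑ i, c (τ i) * x t i ≤ ∑ i, c (σ i) * x t i) →
      ∀ i j, x t j ≤ x t i → p t σ i j + p t σ j i ≤
        -((q t i j + q t j i) / 2) + (2 * C + 1) * Real.exp (-t) := by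
    intro σ t ht hm i j hji
    have he : φ (x t i - x t j) = φ (x t j - x t i) := by
      rw [← hφ_even]; congr 1; ring
    have hord : 0 < x t i - x t j → 2 * (N : ℝ) * c (σ j) ≤ c (σ i) := by
      intro hlt
      have hij : i ≠ j := by rintro rfl; simp at hlt
      have h1 := Aux8.swap_est c (x t) σ i j hij (hm _)
      have h2 : c (σ j) ≤ c (σ i) := by
        by_contra! hcon
        nlinarith
      rcases lt_trichotomy (σ j) (σ i) with h | h | h
      · exact hclt _ _ h
      · exact absurd (σ.injective h).symm hij
      · exfalso
        have h3 := hclt _ _ h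
        nlinarith [hc1 (σ i)]
    have := Aux8.pair_est N (c (σ i)) (c (σ j)) (w t i j) (w t j i) (∑ l, w t i l)
      (∑ l, w t j l) (Real.exp (-t)) (φ (x t j - x t i)) (x t i - x t j) C hN1
      (hk1 t ht i) (hkN t ht i) (hk1 t ht j) (hw0 t ht i j) (hw0 t ht j i)
      (Real.exp_pos _).le (hsym i j t ht) (hφ_range _).1 (hφ_range _).2 (by linarith)
      (by linarith [hxle i t ht, hxge j t ht]) (hc1 _) (hcC _) hord
    simp only [hp, hq, he]
    rw [abs_of_nonpos (show x t j - x t i ≤ 0 by linarith),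
      abs_of_nonneg (show 0 ≤ x t i - x t j by linarith), neg_sub]
    rw [neg_sub] at this
    exact this
  set K : ℝ := (N : ℝ) * (N * (2 * C + 1)) with hK
  have hest : ∀ (σ : Equiv.Perm (Fin N)) t, 0 ≤ t →
      (∀ τ : Equiv.Perm (Fin N), ∑ i, c (τ i) * x t i ≤ ∑ i, c (σ i) * x t i) →
      ∑ i, ∑ j, p t σ i j ≤ -(D t / 2) + K / 2 * Real.exp (-t) := by
    intro σ t ht hm
    have h1 : ∀ i j, p t σ i j + p t σ j i ≤
        -((q t i j + q t j i) / 2) + (2 * C + 1) * Real.exp (-t) := by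
      intro i j
      rcases le_total (x t j) (x t i) with h | h
      · exact hpair σ t ht hm i j h
      · have := hpair σ t ht hm j i h
        linarith
    have h2 : ∑ i, ∑ j, (p t σ i j + p t σ j i) ≤
        ∑ i : Fin N, ∑ j : Fin N,
          (-((q t i j + q t j i) / 2) + (2 * C + 1) * Real.exp (-t)) :=
      Finset.sum_le_sum (fun i _ => Finset.sum_le_sum (fun j _ => h1 i j))
    have h3 : ∑ i, ∑ j, p t σ j i = ∑ i, ∑ j, p t σ i j := Finset.sum_comm
    have h4 : ∑ i, ∑ j, q t j i = D t := Finset.sum_comm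
    have h5 : ∑ i, ∑ j, q t i j = D t := rfl
    simp only [Finset.sum_add_distrib, Finset.sum_neg_distrib, ← Finset.sum_div, h3, h4, h5,
      Finset.sum_const, Finset.card_univ, Fintype.card_fin, nsmul_eq_mul] at h2
    rw [hK]
    linarith
  have hV1 : ∀ (σ : Equiv.Perm (Fin N)) t, 0 ≤ t → |∑ i, c (σ i) * x t i| ≤ N * C := by
    intro σ t ht
    calc |∑ i, c (σ i) * x t i| ≤ ∑ i, |c (σ i) * x t i| := Finset.abs_sum_le_sum_abs _ _
      _ ≤ ∑ _i : Fin N, C := by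
          refine Finset.sum_le_sum (fun i _ => ?_)
          have hx1 : |x t i| ≤ 1 := abs_le.2 ⟨by linarith [hxge i t ht], hxle i t ht⟩
          rw [abs_mul, abs_of_nonneg (by linarith [hc1 (σ i)])]
          nlinarith [hc1 (σ i), hcC (σ i)]
      _ = N * C := by simp
  have hmain := Aux8.maxp (ι := Equiv.Perm (Fin N))
    (fun σ t => ∑ i, c (σ i) * x t i + g t / 2 + K / 2 * Real.exp (-t))
    (fun σ t => ∑ i, ∑ j, p t σ i j + D t / 2 + K / 2 * (-Real.exp (-t)))
    (fun σ t ht => by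
      have he : HasDerivAt (fun t : ℝ => Real.exp (-t)) (-Real.exp (-t)) t := by
        simpa using (hasDerivAt_neg t).exp
      exact ((hVd σ t ht).add ((hgd t ht).div_const 2)).add (he.const_mul (K / 2)))
    (fun σ t ht hm => by
      have := hest σ t ht (fun τ => by linarith [hm τ])
      linarith)
    (N * C + K / 2)
    (fun σ => by
      have := (abs_le.1 (hV1 σ 0 le_rfl)).2
      simp only [hg0, neg_zero, Real.exp_zero]
      linarith)
  have hK0 : 0 ≤ K := by
    have : 0 ≤ C := by positivity
    positivity
  have hgb : ∀ t, 0 ≤ t → g t ≤ 4 * (N * C) + K := by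
    intro t ht
    have h1 := hmain 1 t ht
    have h2 := (abs_le.1 (hV1 1 t ht)).1
    have h3 : 0 ≤ K / 2 * Real.exp (-t) := by positivity
    linarith
  have hD0 : ∀ t, 0 ≤ t → 0 ≤ D t := fun t ht =>
    Finset.sum_nonneg (fun i _ => Finset.sum_nonneg (fun j _ => hq0 t ht i j))
  obtain ⟨gl, hgl⟩ := Aux8.conv_of_mono _ (Aux8.mono_of_deriv 0 hgd hD0) hgb
  have hxconv : ∀ i, ∃ l, Tendsto (fun t => x t i) atTop (𝓝 l) := by
    intro i
    have hm := Aux8.mono_of_deriv 0 (fun t ht => (hx i t ht).add (hgd t ht)) (by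
      intro t ht
      have h1 : |(1 / ∑ j, w t i j) * ∑ j, w t i j * φ (x t j - x t i) * (x t j - x t i)|
          ≤ D t := by
        rw [abs_mul]
        have hk := hk1 t ht i
        have ha : |1 / ∑ j, w t i j| ≤ 1 := by
          rw [abs_of_nonneg (by positivity)]
          exact (div_le_one (by linarith)).2 hk
        have hb : |∑ j, w t i j * φ (x t j - x t i) * (x t j - x t i)| ≤ D t := by
          refine (Finset.abs_sum_le_sum_abs _ _).trans (le_trans (le_of_eq ?_) (hqsD t ht i))
          refine Finset.sum_congr rfl (fun j _ => ?_)
          simp only [hq]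
          rw [abs_mul, abs_of_nonneg (mul_nonneg (hw0 t ht i j) (hφ_range _).1)]
        calc _ ≤ 1 * |∑ j, w t i j * φ (x t j - x t i) * (x t j - x t i)| :=
              mul_le_mul_of_nonneg_right ha (abs_nonneg _)
          _ ≤ D t := by linarith
      linarith [(abs_le.1 h1).1])
    obtain ⟨l, hl⟩ := Aux8.conv_of_mono (1 + (4 * (N * C) + K)) hm
      (fun t ht => add_le_add (hxle i t ht) (hgb t ht))
    refine ⟨l - gl, (hl.sub hgl).congr (fun t => ?_)⟩
    simp
  choose xl hxl using hxconv
  intro i j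
  by_cases hij : i = j
  · subst hij
    left
    refine ⟨by simp, ?_⟩
    refine tendsto_const_nhds.congr' ?_
    filter_upwards [eventually_ge_atTop 0] with t ht
    exact (hwdiag t ht i).symm
  have hdiff : Tendsto (fun t => x t j - x t i) atTop (𝓝 (xl j - xl i)) := (hxl j).sub (hxl i)
  have hφl : Tendsto (fun t => φ (x t j - x t i)) atTop (𝓝 (φ (xl j - xl i))) :=
    (hφc.tendsto _).comp hdiff
  have hwl : Tendsto (fun t => w t i j) atTop (𝓝 (φ (xl j - xl i))) :=
    Aux8.relax (hw i j hij) hφl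
  have hql : Tendsto (fun t => q t i j) atTop
      (𝓝 (φ (xl j - xl i) * φ (xl j - xl i) * |xl j - xl i|)) :=
    (hwl.mul hφl).mul hdiff.abs
  have hDl : ∃ L, Tendsto D atTop (𝓝 L) := by
    refine ⟨∑ i, ∑ j, (if i = j then 1 else φ (xl j - xl i)) * φ (xl j - xl i) * |xl j - xl i|,
      tendsto_finsetSum _ (fun a _ => tendsto_finsetSum _ (fun b _ => ?_))⟩
    have hd : Tendsto (fun t => x t b - x t a) atTop (𝓝 (xl b - xl a)) := (hxl b).sub (hxl a)
    have hf : Tendsto (fun t => φ (x t b - x t a)) atTop (𝓝 (φ (xl b - xl a))) :=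
      (hφc.tendsto _).comp hd
    refine Tendsto.mul (Tendsto.mul ?_ hf) hd.abs
    split_ifs with hab
    · subst hab
      refine tendsto_const_nhds.congr' ?_
      filter_upwards [eventually_ge_atTop 0] with t ht
      exact (hwdiag t ht a).symm
    · exact Aux8.relax (hw a b hab) hf
  obtain ⟨L, hL⟩ := hDl
  have hL0 : L ≤ 0 := Aux8.lim_nonpos hgd hgb hL
  have hle : φ (xl j - xl i) * φ (xl j - xl i) * |xl j - xl i| ≤ L := by
    refine le_of_tendsto_of_tendsto hql hL ?_
    filter_upwards [eventually_ge_atTop 0] with t ht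
    exact hqD t ht i j
  have hzero : φ (xl j - xl i) * φ (xl j - xl i) * |xl j - xl i| = 0 :=
    le_antisymm (hle.trans hL0)
      (mul_nonneg (mul_self_nonneg _) (abs_nonneg _))
  rcases mul_eq_zero.1 hzero with h | h
  · right
    have h0 : φ (xl j - xl i) = 0 := mul_self_eq_zero.1 h
    rw [h0] at hφl hwl
    exact ⟨hφl, hwl⟩
  · left
    have h0 : xl j - xl i = 0 := abs_eq_zero.1 h
    rw [h0] at hdiff hwl
    rw [hφ0] at hwl
    exact ⟨hdiff, hwl⟩
end

section
/- Suppose φ is a smooth bounded-confidence interaction function with radius R ∈ (0,2) and the system follows memory weight dynamics. Assume the population remains an R-chain for all time: for every t ≥ 0, if the opinions x_1(t), …, x_N(t) are sorted in increasing order then each consecutive gap is strictly smaller than R. Then every opinion converges as t → ∞, the minimum opinion min_i x_i(t) converges to some limit x*, and for every individual i there exists a nonnegative integer n_i such that x_i(t) → x* + n_i·R as t → ∞. -/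
open Filter Topology MeasureTheory

lemma aux_min_mono {ι : Type} [Fintype ι] [Nonempty ι] (f f' : ι → ℝ → ℝ) (T : ℝ)
    (hd : ∀ i t, T ≤ t → HasDerivAt (f i) (f' i t) t)
    (hact : ∀ i t, T ≤ t → (∀ j, f i t ≤ f j t) → 0 ≤ f' i t)
    (s t : ℝ) (hs : T ≤ s) (hst : s ≤ t) : (⨅ i, f i s) ≤ ⨅ i, f i t := by
  have hcont : ContinuousOn (fun z => -(⨅ i, f i z)) (Set.Icc s t) := by
    have : ContinuousOn (fun z => Finset.univ.inf' Finset.univ_nonempty (fun i => f i z))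
        (Set.Icc s t) := by
      apply ContinuousOn.finset_inf'_apply
      intro i _ z hz
      exact (hd i z (hs.trans hz.1)).continuousAt.continuousWithinAt
    simp only [Finset.inf'_univ_eq_ciInf] at this
    exact this.neg
  have key := image_le_of_liminf_slope_right_le_deriv_boundary
    (f := fun z => -(⨅ i, f i z)) (a := s) (b := t) hcont
    (B := fun _ => -(⨅ i, f i s)) (B' := fun _ => 0) le_rfl continuousOn_const
    (fun z _ => hasDerivWithinAt_const _ _ _) ?_ (Set.right_mem_Icc.2 hst)
  · simpa using key
  intro z hz r hr
  apply Eventually.frequently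
  have hzT : T ≤ z := hs.trans hz.1
  have hall : ∀ i, ∀ᶠ y in 𝓝[>] z, (⨅ i, f i z) - r * (y - z) < f i y := by
    intro i
    have hle : (⨅ i, f i z) ≤ f i z := ciInf_le (Set.finite_range _).bddBelow i
    rcases hle.lt_or_eq with h | h
    · have h1 := ((hd i z hzT).continuousAt.continuousWithinAt (s := Set.Ioi z)).eventually
        (lt_mem_nhds h)
      filter_upwards [h1, self_mem_nhdsWithin] with y hy hy2
      have : 0 < y - z := sub_pos.2 hy2
      nlinarith
    · have hpos := hact i z hzT (fun j => h ▸ ciInf_le (Set.finite_range _).bddBelow j)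
      have h2 := ((hd i z hzT).hasDerivWithinAt (s := Set.Ioi z))
      rw [hasDerivWithinAt_iff_tendsto_slope' (by simp)] at h2
      have h3 := h2.eventually (lt_mem_nhds (show -r < f' i z by linarith))
      filter_upwards [h3, self_mem_nhdsWithin] with y hy hy2
      have hyz : 0 < y - z := sub_pos.2 hy2
      rw [slope_def_field, lt_div_iff₀ hyz] at hy
      rw [h]; linarith
  filter_upwards [eventually_all.2 hall, self_mem_nhdsWithin] with y hy hy2
  have hyz : 0 < y - z := sub_pos.2 hy2
  obtain ⟨i, hi⟩ := exists_eq_ciInf_of_finite (f := fun i => f i y)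
  have := hy i
  rw [slope_def_field, div_lt_iff₀ hyz]
  rw [← hi]; linarith

lemma aux_mono (f f' : ℝ → ℝ) (T : ℝ)
    (hd : ∀ t, T ≤ t → HasDerivAt f (f' t) t) (h0 : ∀ t, T ≤ t → 0 ≤ f' t)
    (s t : ℝ) (hs : T ≤ s) (hst : s ≤ t) : f s ≤ f t := by
  have := aux_min_mono (ι := Unit) (fun _ => f) (fun _ => f') T (fun _ => hd)
    (fun _ t ht _ => h0 t ht) s t hs hst
  simpa using this

lemma aux_conv (F : ℝ → ℝ) (hF : ∀ s t, 0 ≤ s → s ≤ t → F s ≤ F t) (C : ℝ)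
    (hC : ∀ t, 0 ≤ t → F t ≤ C) : ∃ l, Tendsto F atTop (𝓝 l) := by
  have hm : Monotone (fun t => F (max t 0)) := fun a b hab =>
    hF _ _ (le_max_right _ _) (max_le_max hab le_rfl)
  have hb : BddAbove (Set.range (fun t => F (max t 0))) := by
    refine ⟨C, ?_⟩
    rintro _ ⟨t, rfl⟩
    exact hC _ (le_max_right _ _)
  refine ⟨_, (tendsto_atTop_ciSup hm hb).congr' ?_⟩
  filter_upwards [eventually_ge_atTop 0] with t ht
  rw [max_eq_left ht]

lemma aux_lower (N : ℕ) (hN : 1 ≤ N) (x : ℝ → Fin N → ℝ) (c : ℝ → Fin N → Fin N → ℝ)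
    (hc0 : ∀ t, 0 ≤ t → ∀ i j, 0 ≤ c t i j)
    (hx : ∀ i t, 0 ≤ t → HasDerivAt (fun s => x s i) (∑ j, c t i j * (x t j - x t i)) t)
    (hx0 : ∀ i, -1 ≤ x 0 i) (t : ℝ) (ht : 0 ≤ t) (i : Fin N) : -1 ≤ x t i := by
  have : Nonempty (Fin N) := ⟨⟨0, hN⟩⟩
  have h := aux_min_mono (fun i s => x s i) (fun i t => ∑ j, c t i j * (x t j - x t i)) 0
    hx (fun i t ht hj => Finset.sum_nonneg fun j _ =>
      mul_nonneg (hc0 t ht i j) (sub_nonneg.2 (hj j))) 0 t le_rfl ht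
  have h1 : -1 ≤ ⨅ i, x 0 i := le_ciInf hx0
  have h2 : (⨅ i, x t i) ≤ x t i := ciInf_le (Set.finite_range _).bddBelow i
  linarith

lemma aux_abs (N : ℕ) (hN : 1 ≤ N) (x : ℝ → Fin N → ℝ) (c : ℝ → Fin N → Fin N → ℝ)
    (hc0 : ∀ t, 0 ≤ t → ∀ i j, 0 ≤ c t i j)
    (hx : ∀ i t, 0 ≤ t → HasDerivAt (fun s => x s i) (∑ j, c t i j * (x t j - x t i)) t)
    (hx0 : ∀ i, x 0 i ∈ Set.Icc (-1:ℝ) 1) (t : ℝ) (ht : 0 ≤ t) (i : Fin N) :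
    |x t i| ≤ 1 := by
  have h1 := aux_lower N hN x c hc0 hx (fun i => (hx0 i).1) t ht i
  have h2 := aux_lower N hN (fun t i => - x t i) c hc0 (fun i t ht => by
    have h3 : ∑ j, c t i j * (-x t j - -x t i) = -∑ j, c t i j * (x t j - x t i) := by
      rw [← Finset.sum_neg_distrib]
      exact Finset.sum_congr rfl fun j _ => by ring
    rw [h3]
    exact (hx i t ht).neg) (fun i => neg_le_neg (hx0 i).2) t ht i
  rw [abs_le]
  exact ⟨h1, by linarith⟩

/-- Pairwise estimate for sorted values. -/
lemma aux_pair (N : ℕ) (hN : 1 ≤ N) (q e : ℝ) (hq : q = 1 / (4 * N)) (he : 0 ≤ e)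
    (a : Fin N → Fin N → ℝ) (z : Fin N → ℝ) (hz : Monotone z) (ha : ∀ k l, 0 ≤ a k l)
    (has : ∀ k l, a l k ≤ N * a k l + e) (hb : ∀ k, |z k| ≤ 1) (k l : Fin N) (hkl : k ≤ l) :
    q ^ (N + 1) * (a k l * |z l - z k| + a l k * |z k - z l|) - 2 * e ≤
      q ^ (k : ℕ) * (a k l * (z l - z k)) + q ^ (l : ℕ) * (a l k * (z k - z l)) := by
  rcases hkl.eq_or_lt with rfl | hlt
  · simp; linarith
  have hNR : (1:ℝ) ≤ N := by exact_mod_cast hN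
  have hq0 : 0 < q := by rw [hq]; positivity
  have hqN : q * N = 1 / 4 := by rw [hq]; field_simp
  have hq1 : q ≤ 1 / 4 := by nlinarith
  have hd : 0 ≤ z l - z k := sub_nonneg.2 (hz hkl)
  have hd2 : z l - z k ≤ 2 := by
    have h1 := abs_le.1 (hb l); have h2 := abs_le.1 (hb k); linarith
  rw [abs_sub_comm (z k), abs_of_nonneg hd, show z k - z l = -(z l - z k) by ring]
  have hlt' : (k : ℕ) + 1 ≤ l := hlt
  have hpl : q ^ (l : ℕ) ≤ q * q ^ (k : ℕ) := by
    rw [← pow_succ']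
    exact pow_le_pow_of_le_one hq0.le (by linarith) hlt'
  have hη : q ^ (N + 1) ≤ q * q ^ (k : ℕ) := by
    rw [← pow_succ']
    exact pow_le_pow_of_le_one hq0.le (by linarith) (by omega)
  have hk1 : q ^ (k : ℕ) ≤ 1 := pow_le_one₀ hq0.le (by linarith)
  have hk0 : 0 < q ^ (k : ℕ) := pow_pos hq0 _
  have hl0 : 0 < q ^ (l : ℕ) := pow_pos hq0 _
  have hη0 : 0 < q ^ (N + 1) := pow_pos hq0 _
  generalize q ^ (k : ℕ) = pk at *
  generalize q ^ (l : ℕ) = pl at *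
  generalize q ^ (N + 1) = η at *
  generalize z l - z k = d at *
  have A := ha k l
  have B := has k l
  generalize a k l = u at *
  generalize a l k = v at *
  have h1 : (pl + η) * v ≤ (pl + η) * (N * u + e) := mul_le_mul_of_nonneg_left B (by positivity)
  have h2 : (pl + η) * N ≤ pk / 2 := by
    have : (pl + η) * N ≤ (2 * (q * pk)) * N := by gcongr; linarith
    nlinarith
  have h3 : η ≤ pk / 4 := by nlinarith
  have h4 : pl + η ≤ 1 := by nlinarith
  have h5 : (pl + η) * (N * u + e) + η * u ≤ pk * u + e := by
    have : (pl + η) * N * u ≤ pk / 2 * u := by gcongr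
    have : η * u ≤ pk / 4 * u := by gcongr
    have : (pl + η) * e ≤ 1 * e := by gcongr
    nlinarith [mul_nonneg hk0.le A]
  have h6 : (η * (u + v) - (pk * u - pl * v)) * d ≤ e * 2 := by
    calc _ ≤ e * d := by gcongr; linarith
      _ ≤ e * 2 := by gcongr
  linarith

lemma aux_sorted (N : ℕ) (p : Fin N → ℝ) (hp : StrictAnti p) (z : Fin N → ℝ)
    (σ : Equiv.Perm (Fin N))
    (h : ∀ τ : Equiv.Perm (Fin N), ∑ k, p k * z (σ k) ≤ ∑ k, p k * z (τ k)) :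
    Monotone (fun k => z (σ k)) := by
  set τ := Tuple.sort z
  have hm : Monotone (z ∘ τ) := Tuple.monotone_sort z
  have hav : Antivary p (z ∘ τ) := hp.antitone.antivary hm
  have heq : ∑ k, p k * (z ∘ τ) ((τ⁻¹ * σ) k) = ∑ k, p k * z (σ k) := by simp
  have h1 := hav.sum_mul_le_sum_mul_comp_perm (σ := τ⁻¹ * σ)
  have h2 := (hav.sum_mul_eq_sum_mul_comp_perm_iff (σ := τ⁻¹ * σ)).1
    (le_antisymm (heq.trans_le (h τ)) h1)
  intro a b hab
  by_contra hlt
  push Not at hlt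
  have h3 : p a ≤ p b := h2 (i := b) (j := a) (by simpa using hlt)
  have : a ≠ b := by rintro rfl; exact lt_irrefl _ hlt
  exact absurd (hp (lt_of_le_of_ne hab this)) (not_lt.2 h3)

lemma aux_sum (N : ℕ) (hN : 1 ≤ N) (q e : ℝ) (hq : q = 1 / (4 * N)) (he : 0 ≤ e)
    (a : Fin N → Fin N → ℝ) (z : Fin N → ℝ) (hz : Monotone z) (ha : ∀ k l, 0 ≤ a k l)
    (has : ∀ k l, a l k ≤ N * a k l + e) (hb : ∀ k, |z k| ≤ 1) :
    q ^ (N + 1) * (∑ k, ∑ l, a k l * |z l - z k|) - N ^ 2 * e ≤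
      ∑ k : Fin N, q ^ (k : ℕ) * ∑ l, a k l * (z l - z k) := by
  have hpair : ∀ k l : Fin N,
      q ^ (N + 1) * (a k l * |z l - z k| + a l k * |z k - z l|) - 2 * e ≤
      q ^ (k : ℕ) * (a k l * (z l - z k)) + q ^ (l : ℕ) * (a l k * (z k - z l)) := by
    intro k l
    rcases le_total k l with h | h
    · exact aux_pair N hN q e hq he a z hz ha has hb k l h
    · have := aux_pair N hN q e hq he a z hz ha has hb l k h
      linarith
  have hs := Finset.sum_le_sum fun k (_ : k ∈ Finset.univ) =>
    Finset.sum_le_sum fun l (_ : l ∈ Finset.univ) => hpair k l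
  simp only [mul_add, Finset.sum_add_distrib, Finset.sum_sub_distrib, Finset.sum_const,
    Finset.card_univ, Fintype.card_fin, nsmul_eq_mul] at hs
  rw [Finset.sum_comm (f := fun k l => q ^ (N + 1) * (a l k * |z k - z l|)),
    Finset.sum_comm (f := fun k l : Fin N => q ^ (l : ℕ) * (a l k * (z k - z l)))] at hs
  simp only [← Finset.mul_sum] at hs
  nlinarith

section core

variable (N : ℕ) (hN : 1 ≤ N) (x : ℝ → Fin N → ℝ) (c : ℝ → Fin N → Fin N → ℝ)
    (hc0 : ∀ t, 0 ≤ t → ∀ i j, 0 ≤ c t i j)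
    (hcs : ∀ t, 0 ≤ t → ∀ i j, c t j i ≤ N * c t i j + Real.exp (-t))
    (hx : ∀ i t, 0 ≤ t → HasDerivAt (fun s => x s i) (∑ j, c t i j * (x t j - x t i)) t)
    (hb : ∀ t, 0 ≤ t → ∀ i, |x t i| ≤ 1)

/-- The sorted weighted sum. -/
noncomputable def auxG (N : ℕ) (x : ℝ → Fin N → ℝ) (t : ℝ) : ℝ :=
  ⨅ σ : Equiv.Perm (Fin N), ∑ k : Fin N, (1 / (4 * N : ℝ)) ^ (k : ℕ) * x t (σ k)

lemma aux_inf_sub {ι : Type} [Fintype ι] [Nonempty ι] (f : ι → ℝ) (c : ℝ) :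
    (⨅ i, (f i - c)) = (⨅ i, f i) - c := by
  apply le_antisymm
  · obtain ⟨i, hi⟩ := exists_eq_ciInf_of_finite (f := f)
    rw [← hi]
    exact ciInf_le (Set.finite_range (fun i => f i - c)).bddBelow i
  · refine le_ciInf fun i => ?_
    have : (⨅ i, f i) ≤ f i := ciInf_le (Set.finite_range _).bddBelow i
    linarith

include hN hc0 hcs hx hb in
lemma aux_core (T : ℝ) (hT : 0 ≤ T) (g g' : ℝ → ℝ)
    (hg : ∀ t, T ≤ t → HasDerivAt g (g' t) t)
    (hg' : ∀ t, T ≤ t →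
      g' t ≤ (1 / (4 * N : ℝ)) ^ (N + 1) * ∑ k, ∑ l, c t k l * |x t l - x t k|)
    (s t : ℝ) (hs : T ≤ s) (hst : s ≤ t) :
    auxG N x s - (g s - N ^ 2 * -Real.exp (-s)) ≤
      auxG N x t - (g t - N ^ 2 * -Real.exp (-t)) := by
  have hNR : (1:ℝ) ≤ N := by exact_mod_cast hN
  have hq0 : 0 < (1 / (4 * N : ℝ)) := by positivity
  have hq1 : (1 / (4 * N : ℝ)) < 1 := by
    rw [div_lt_one (by positivity)]; linarith
  generalize hq : (1 / (4 * N : ℝ)) = q at *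
  have key := aux_min_mono
    (fun (σ : Equiv.Perm (Fin N)) t => (∑ k : Fin N, q ^ (k : ℕ) * x t (σ k))
      - (g t - N ^ 2 * -Real.exp (-t)))
    (fun (σ : Equiv.Perm (Fin N)) t =>
      (∑ k : Fin N, q ^ (k : ℕ) * ∑ j, c t (σ k) j * (x t j - x t (σ k)))
      - (g' t - N ^ 2 * Real.exp (-t))) T ?_ ?_ s t hs hst
  · rw [aux_inf_sub, aux_inf_sub] at key
    simpa only [auxG, hq] using key
  · intro σ t ht
    refine HasDerivAt.sub ?_ (HasDerivAt.sub (hg t ht) ?_)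
    · exact HasDerivAt.fun_sum fun k _ => (hx (σ k) t (hT.trans ht)).const_mul _
    · have h1 : HasDerivAt (fun t : ℝ => -Real.exp (-t)) (Real.exp (-t)) t := by
        have := ((hasDerivAt_neg t).exp).neg
        simp only [mul_neg, mul_one, neg_neg] at this
        exact this
      exact h1.const_mul _
  · intro σ t ht hact
    have ht0 := hT.trans ht
    have hmono := aux_sorted N (fun k : Fin N => q ^ (k : ℕ))
      (fun a b hab => pow_lt_pow_right_of_lt_one₀ hq0 hq1 hab) (x t) σ
      (fun τ => by have := hact τ; simpa using this)
    have h := aux_sum N hN q (Real.exp (-t)) hq.symm (Real.exp_pos _).le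
      (fun k l => c t (σ k) (σ l)) (fun k => x t (σ k)) hmono
      (fun k l => hc0 t ht0 _ _) (fun k l => hcs t ht0 _ _) (fun k => hb t ht0 _)
    have e1 : ∀ k, ∑ l, c t (σ k) (σ l) * (x t (σ l) - x t (σ k)) =
        ∑ j, c t (σ k) j * (x t j - x t (σ k)) := fun k =>
      Equiv.sum_comp σ (fun j => c t (σ k) j * (x t j - x t (σ k)))
    have e2 : ∑ k, ∑ l, c t (σ k) (σ l) * |x t (σ l) - x t (σ k)| =
        ∑ k, ∑ l, c t k l * |x t l - x t k| := by
      rw [← Equiv.sum_comp σ (fun k => ∑ l, c t k l * |x t l - x t k|)]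
      exact Finset.sum_congr rfl fun k _ =>
        Equiv.sum_comp σ (fun j => c t (σ k) j * |x t j - x t (σ k)|)
    simp only [e1, e2] at h
    have := hg' t ht
    linarith

include hN hb in
lemma auxG_le (t : ℝ) (ht : 0 ≤ t) : auxG N x t ≤ N := by
  have hNR : (1:ℝ) ≤ N := by exact_mod_cast hN
  have hq0 : 0 < (1 / (4 * N : ℝ)) := by positivity
  have hq1 : (1 / (4 * N : ℝ)) < 1 := by
    rw [div_lt_one (by positivity)]; linarith
  have h1 : auxG N x t ≤ ∑ k : Fin N, (1 / (4 * N : ℝ)) ^ (k : ℕ) * x t ((1 : Equiv.Perm (Fin N)) k) :=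
    ciInf_le (Set.finite_range (fun σ : Equiv.Perm (Fin N) =>
      ∑ k : Fin N, (1 / (4 * N : ℝ)) ^ (k : ℕ) * x t (σ k))).bddBelow 1
  refine h1.trans ?_
  calc _ ≤ ∑ k : Fin N, (1 : ℝ) := by
        refine Finset.sum_le_sum fun k _ => ?_
        have h2 := (abs_le.1 (hb t ht k)).2
        have h3 : (1 / (4 * N : ℝ)) ^ (k : ℕ) ≤ 1 := pow_le_one₀ hq0.le hq1.le
        have h4 : 0 < (1 / (4 * N : ℝ)) ^ (k : ℕ) := pow_pos hq0 _
        simp only [Equiv.Perm.coe_one, id]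
        nlinarith
    _ = N := by simp

include hN hc0 hcs hx hb in
lemma aux_limits (i : Fin N) : ∃ l, Tendsto (fun t => x t i) atTop (𝓝 l) := by
  have hNR : (1:ℝ) ≤ N := by exact_mod_cast hN
  have hη : 0 < (1 / (4 * N : ℝ)) ^ (N + 1) := by positivity
  set η := (1 / (4 * N : ℝ)) ^ (N + 1) with hηdef
  have hterm : ∀ t, 0 ≤ t → ∀ k l, 0 ≤ c t k l * |x t l - x t k| := fun t ht k l =>
    mul_nonneg (hc0 t ht k l) (abs_nonneg _)
  have hexp : ∀ t : ℝ, 0 ≤ t → Real.exp (-t) ≤ 1 := fun t ht => by simpa using ht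
  obtain ⟨l1, h1⟩ := aux_conv _ (fun s t hs hst => aux_core N hN x c hc0 hcs hx hb 0 le_rfl
    (fun _ => 0) (fun _ => 0) (fun t _ => hasDerivAt_const _ _)
    (fun t ht => mul_nonneg hη.le (Finset.sum_nonneg fun k _ =>
      Finset.sum_nonneg fun l _ => hterm t ht k l)) s t hs hst) N (fun t ht => by
        have := auxG_le N hN x hb t ht
        have : 0 ≤ (N:ℝ) ^ 2 * Real.exp (-t) := by positivity
        linarith)
  obtain ⟨l2, h2⟩ := aux_conv _ (fun s t hs hst => aux_core N hN x c hc0 hcs hx hb 0 le_rfl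
    (fun t => η * x t i) (fun t => η * ∑ j, c t i j * (x t j - x t i))
    (fun t ht => (hx i t ht).const_mul _)
    (fun t ht => by
      refine mul_le_mul_of_nonneg_left ?_ hη.le
      calc _ ≤ ∑ l, c t i l * |x t l - x t i| := Finset.sum_le_sum fun j _ =>
            mul_le_mul_of_nonneg_left (le_abs_self _) (hc0 t ht i j)
        _ ≤ _ := Finset.single_le_sum (f := fun k => ∑ l, c t k l * |x t l - x t k|)
            (fun k _ => Finset.sum_nonneg fun l _ => hterm t ht k l) (Finset.mem_univ i))
    s t hs hst) (N + η) (fun t ht => by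
        have := auxG_le N hN x hb t ht
        have : 0 ≤ (N:ℝ) ^ 2 * Real.exp (-t) := by positivity
        have h2 := (abs_le.1 (hb t ht i)).1
        nlinarith)
  refine ⟨(l1 - l2) / η, ((h1.sub h2).div_const η).congr fun t => ?_⟩
  field_simp
  ring

include hN hc0 hcs hx hb in
/-- No pair keeps a positive dissipation forever. -/
lemma aux_contra (i j : Fin N) (T δ : ℝ) (hT : 0 ≤ T) (hδ : 0 < δ)
    (h : ∀ t, T ≤ t → δ ≤ c t i j * |x t j - x t i|) : False := by
  have hNR : (1:ℝ) ≤ N := by exact_mod_cast hN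
  have hη : 0 < (1 / (4 * N : ℝ)) ^ (N + 1) := by positivity
  have hterm : ∀ t, 0 ≤ t → ∀ k l, 0 ≤ c t k l * |x t l - x t k| := fun t ht k l =>
    mul_nonneg (hc0 t ht k l) (abs_nonneg _)
  have hm := aux_core N hN x c hc0 hcs hx hb T hT
    (fun t => ((1 / (4 * N : ℝ)) ^ (N + 1) * δ) * t) (fun t => (1 / (4 * N : ℝ)) ^ (N + 1) * δ)
    (fun t _ => by simpa using (hasDerivAt_id t).const_mul ((1 / (4 * N : ℝ)) ^ (N + 1) * δ))
    (fun t ht => by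
      have ht0 := hT.trans ht
      refine mul_le_mul_of_nonneg_left ?_ hη.le
      calc δ ≤ c t i j * |x t j - x t i| := h t ht
        _ ≤ ∑ l, c t i l * |x t l - x t i| :=
            Finset.single_le_sum (f := fun l => c t i l * |x t l - x t i|)
              (fun l _ => hterm t ht0 i l) (Finset.mem_univ j)
        _ ≤ _ := Finset.single_le_sum (f := fun k => ∑ l, c t k l * |x t l - x t k|)
            (fun k _ => Finset.sum_nonneg fun l _ => hterm t ht0 k l) (Finset.mem_univ i))
    T
  set κ := (1 / (4 * N : ℝ)) ^ (N + 1) * δ with hκ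
  have hκ0 : 0 < κ := mul_pos hη hδ
  set A := auxG N x T - (κ * T - N ^ 2 * -Real.exp (-T)) with hA
  obtain ⟨t, ht⟩ : ∃ t : ℝ, T ≤ t ∧ (N - A) / κ < t :=
    ⟨max T ((N - A) / κ + 1), le_max_left _ _, lt_of_lt_of_le (lt_add_one _) (le_max_right _ _)⟩
  have h1 := hm t le_rfl ht.1
  have h2 := auxG_le N hN x hb t (hT.trans ht.1)
  have h3 := ht.2
  rw [div_lt_iff₀ hκ0] at h3
  have : 0 ≤ (N:ℝ) ^ 2 * Real.exp (-t) := by positivity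
  linarith

end core

lemma aux_gap (N : ℕ) (z : Fin N → ℝ) (R c : ℝ)
    (hch : ∀ σ : Equiv.Perm (Fin N), Monotone (fun i => z (σ i)) →
      ∀ i j : Fin N, (i : ℕ) + 1 = (j : ℕ) → z (σ j) - z (σ i) < R)
    (i j : Fin N) (hj : z j ≤ c) (hi : c < z i) :
    ∃ i' j', z j' ≤ c ∧ c < z i' ∧ z i' - z j' < R := by
  set τ := Tuple.sort z
  have hm : Monotone (fun i => z (τ i)) := Tuple.monotone_sort z
  have hne : (Finset.univ.filter fun k => c < z (τ k)).Nonempty :=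
    ⟨τ.symm i, by simpa using hi⟩
  set k := (Finset.univ.filter fun k => c < z (τ k)).min' hne with hk
  have hkm : c < z (τ k) := by
    have := Finset.min'_mem _ hne
    rw [← hk] at this
    simpa using this
  have hmin : ∀ l, c < z (τ l) → k ≤ l := fun l hl => Finset.min'_le _ _ (by simpa using hl)
  have hk0 : 0 < (k : ℕ) := by
    by_contra h0
    have h1 : k ≤ τ.symm j := by rw [Fin.le_def]; omega
    have h2 := hm h1
    simp only [Equiv.apply_symm_apply] at h2
    linarith
  have hkN := k.2
  let m : Fin N := ⟨k - 1, by omega⟩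
  have hmk : (m : ℕ) + 1 = k := by simp only [m]; omega
  refine ⟨τ k, τ m, ?_, hkm, hch τ hm m k hmk⟩
  by_contra hlt
  have h1 := hmin m (not_le.1 hlt)
  rw [Fin.le_def] at h1
  omega

lemma aux_final (N : ℕ) (hN : 1 ≤ N) (x : ℝ → Fin N → ℝ) (l : Fin N → ℝ) (R : ℝ) (hR : 0 < R)
    (hl : ∀ i, Tendsto (fun t => x t i) atTop (𝓝 (l i)))
    (hsep : ∀ i j, l i < l j → R ≤ l j - l i)
    (hchain : ∀ t : ℝ, 0 ≤ t → ∀ σ : Equiv.Perm (Fin N),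
      Monotone (fun i => x t (σ i)) →
      ∀ i j : Fin N, (i : ℕ) + 1 = (j : ℕ) → x t (σ j) - x t (σ i) < R) :
    ∃ xstar : ℝ, Tendsto (fun t => ⨅ i, x t i) atTop (𝓝 xstar) ∧
      ∀ i, ∃ n : ℕ, Tendsto (fun t => x t i) atTop (𝓝 (xstar + (n : ℝ) * R)) := by
  have : Nonempty (Fin N) := ⟨⟨0, hN⟩⟩
  refine ⟨⨅ i, l i, ?_, ?_⟩
  · have := Filter.Tendsto.finset_inf'_nhds (s := Finset.univ) (f := fun i t => x t i) (g := l)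
      (l := atTop) Finset.univ_nonempty (fun i _ => hl i)
    rw [Finset.inf'_univ_eq_ciInf l] at this
    refine this.congr fun t => ?_
    rw [Finset.inf'_apply, Finset.inf'_univ_eq_ciInf]
  set m := ⨅ i, l i with hm
  have hmle : ∀ i, m ≤ l i := fun i => ciInf_le (Set.finite_range _).bddBelow i
  obtain ⟨i0, hi0⟩ := exists_eq_ciInf_of_finite (f := l)
  have hstep : ∀ i, m < l i → ∃ j, l j = l i - R := by
    intro i hi
    have hne : (Finset.univ.filter fun j => l j < l i).Nonempty := ⟨i0, by simpa [hi0] using hi⟩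
    obtain ⟨j, hj, hjmax⟩ := Finset.exists_max_image _ l hne
    simp only [Finset.mem_filter, Finset.mem_univ, true_and] at hj hjmax
    refine ⟨j, ?_⟩
    have h1 := hsep j i hj
    suffices l i - l j ≤ R by linarith
    refine le_of_forall_pos_le_add fun ε hε => ?_
    have hδ : 0 < min (ε / 2) ((l i - l j) / 2) := lt_min (by linarith) (by linarith)
    set δ := min (ε / 2) ((l i - l j) / 2) with hδd
    have hδ1 : δ ≤ ε / 2 := min_le_left _ _
    have hδ2 : δ ≤ (l i - l j) / 2 := min_le_right _ _
    have hev : ∀ᶠ t in atTop, ∀ a, |x t a - l a| < δ := by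
      rw [eventually_all]
      intro a
      have := (Metric.tendsto_nhds.1 (hl a)) δ hδ
      simpa [Real.dist_eq] using this
    obtain ⟨t, hta, ht0⟩ := (hev.and (eventually_ge_atTop 0)).exists
    have hta' : ∀ a, -δ < x t a - l a ∧ x t a - l a < δ := fun a => abs_lt.1 (hta a)
    obtain ⟨i', j', hj', hi', hg⟩ := aux_gap N (x t) R ((l i + l j) / 2) (hchain t ht0) i j
      (by have := (hta' j).2; linarith) (by have := (hta' i).1; linarith)
    have a1 : l j' ≤ l j := by
      apply hjmax
      by_contra hcon
      have := (hta' j').1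
      linarith
    have a2 : l i ≤ l i' := by
      by_contra hcon
      have := hjmax i' (not_le.1 hcon)
      have := (hta' i').2
      linarith
    have := (hta' i').1
    have := (hta' j').2
    linarith
  have hind : ∀ n : ℕ, ∀ i, l i ≤ m + n * R → ∃ n' : ℕ, l i = m + n' * R := by
    intro n
    induction n with
    | zero => intro i hi; exact ⟨0, le_antisymm hi (by simpa using hmle i)⟩
    | succ n ih =>
      intro i hi
      rcases (hmle i).eq_or_lt with h | h
      · exact ⟨0, by simp [← h]⟩
      · obtain ⟨j, hj⟩ := hstep i h
        push_cast at hi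
        obtain ⟨n', hn'⟩ := ih j (by linarith)
        exact ⟨n' + 1, by push_cast; linarith⟩
  intro i
  obtain ⟨n, hn⟩ := exists_nat_ge ((l i - m) / R)
  rw [div_le_iff₀ hR] at hn
  obtain ⟨n', hn'⟩ := hind n i (by linarith)
  exact ⟨n', hn' ▸ hl i⟩

theorem stmt9
    (N : ℕ) (hN : 1 ≤ N)
    (x : ℝ → Fin N → ℝ) (w : ℝ → Fin N → Fin N → ℝ)
    (φ : ℝ → ℝ)
    (hφ_lip : ∃ L : NNReal, LipschitzWith L φ)
    (hφ_range : ∀ r : ℝ, φ r ∈ Set.Icc (0:ℝ) 1)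
    (hφ_even : ∀ r : ℝ, φ (-r) = φ r)
    (hw01 : ∀ t : ℝ, 0 ≤ t → ∀ i j, w t i j ∈ Set.Icc (0:ℝ) 1)
    (hwdiag : ∀ t : ℝ, 0 ≤ t → ∀ i, w t i i = 1)
    (hx0 : ∀ i, x 0 i ∈ Set.Icc (-1:ℝ) 1)
    (hx : ∀ i, ∀ t : ℝ, 0 ≤ t →
      HasDerivAt (fun s => x s i)
        ((1 / ∑ j, w t i j) * ∑ j, w t i j * φ (x t j - x t i) * (x t j - x t i)) t)
    (hw : ∀ i j, i ≠ j → ∀ t : ℝ, 0 ≤ t →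
      HasDerivAt (fun s => w s i j) (φ (x t j - x t i) - w t i j) t)
    (R : ℝ) (hR : R ∈ Set.Ioo (0:ℝ) 2)
    (hφ_pos : ∀ r : ℝ, |r| < R → 0 < φ r)
    (hφ_zero : ∀ r : ℝ, R ≤ |r| → |r| ≤ 2 → φ r = 0)
    (hchain : ∀ t : ℝ, 0 ≤ t → ∀ σ : Equiv.Perm (Fin N),
      Monotone (fun i => x t (σ i)) →
      ∀ i j : Fin N, (i : ℕ) + 1 = (j : ℕ) → x t (σ j) - x t (σ i) < R) :
    (∀ i, ∃ l : ℝ, Tendsto (fun t => x t i) atTop (𝓝 l)) ∧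
    ∃ xstar : ℝ, Tendsto (fun t => ⨅ i, x t i) atTop (𝓝 xstar) ∧
      ∀ i, ∃ n : ℕ, Tendsto (fun t => x t i) atTop (𝓝 (xstar + (n : ℝ) * R)) := by
  obtain ⟨L, hL⟩ := hφ_lip
  have hφc := hL.continuous
  have hNR : (1:ℝ) ≤ N := by exact_mod_cast hN
  have hk1 : ∀ t : ℝ, 0 ≤ t → ∀ i, 1 ≤ ∑ j, w t i j := fun t ht i => by
    rw [← hwdiag t ht i]
    exact Finset.single_le_sum (f := fun j => w t i j) (fun j _ => (hw01 t ht i j).1)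
      (Finset.mem_univ i)
  have hkN : ∀ t : ℝ, 0 ≤ t → ∀ i, ∑ j, w t i j ≤ N := fun t ht i => by
    calc _ ≤ ∑ j : Fin N, (1:ℝ) := Finset.sum_le_sum fun j _ => (hw01 t ht i j).2
      _ = N := by simp
  have hsym : ∀ i j, i ≠ j → ∀ t : ℝ, 0 ≤ t → w t j i - w t i j ≤ Real.exp (-t) := by
    intro i j hij t ht
    have := aux_mono (fun s => (w s i j - w s j i) * Real.exp s)
      (fun s => 0) 0 (fun s hs => by
        have h1 := ((hw i j hij s hs).sub (hw j i hij.symm s hs)).mul (Real.hasDerivAt_exp s)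
        have h2 : φ (x s i - x s j) = φ (x s j - x s i) := by
          rw [← hφ_even]; congr 1; ring
        rw [h2] at h1
        refine h1.congr_deriv ?_
        simp only [Pi.sub_apply]
        ring) (fun s _ => le_rfl) 0 t le_rfl ht
    simp only [Real.exp_zero, mul_one] at this
    have h3 := (hw01 0 le_rfl i j).1
    have h4 := (hw01 0 le_rfl j i).2
    have h5 : (w t j i - w t i j) * Real.exp t ≤ 1 := by linarith
    rw [Real.exp_neg, ← one_div, le_div_iff₀ (Real.exp_pos t)]
    exact h5
  let c : ℝ → Fin N → Fin N → ℝ := fun t i j =>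
    (w t i j * φ (x t j - x t i)) / ∑ k, w t i k
  have hc0 : ∀ t, 0 ≤ t → ∀ i j, 0 ≤ c t i j := fun t ht i j =>
    div_nonneg (mul_nonneg (hw01 t ht i j).1 (hφ_range _).1) (by linarith [hk1 t ht i])
  have hclow : ∀ t, 0 ≤ t → ∀ i j, w t i j * φ (x t j - x t i) ≤ N * c t i j := by
    intro t ht i j
    have h1 := hk1 t ht i
    have h2 : w t i j * φ (x t j - x t i) = (∑ k, w t i k) * c t i j := by
      simp only [c]; field_simp
    rw [h2]
    exact mul_le_mul_of_nonneg_right (hkN t ht i) (hc0 t ht i j)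
  have hcs : ∀ t, 0 ≤ t → ∀ i j, c t j i ≤ N * c t i j + Real.exp (-t) := by
    intro t ht i j
    have he := Real.exp_pos (-t)
    by_cases hij : i = j
    · subst hij
      nlinarith [hc0 t ht i i]
    have h1 : c t j i ≤ w t j i * φ (x t i - x t j) :=
      div_le_self (mul_nonneg (hw01 t ht j i).1 (hφ_range _).1) (hk1 t ht j)
    have h2 : φ (x t i - x t j) = φ (x t j - x t i) := by
      rw [← hφ_even]; congr 1; ring
    rw [h2] at h1
    have h3 := hclow t ht i j
    have h4 := hφ_range (x t j - x t i)
    have h5 := hsym i j hij t ht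
    nlinarith [mul_le_mul_of_nonneg_right h5 h4.1, mul_le_mul_of_nonneg_left h4.2 he.le]
  have hx' : ∀ i t, 0 ≤ t →
      HasDerivAt (fun s => x s i) (∑ j, c t i j * (x t j - x t i)) t := by
    intro i t ht
    refine (hx i t ht).congr_deriv ?_
    rw [Finset.mul_sum]
    exact Finset.sum_congr rfl fun j _ => by simp only [c]; ring
  have hb := aux_abs N hN x c hc0 hx' hx0
  have hlim := aux_limits N hN x c hc0 hcs hx' hb
  refine ⟨hlim, ?_⟩
  choose l hl using hlim
  refine aux_final N hN x l R hR.1 hl ?_ hchain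
  intro i j hij
  by_contra hlt
  push Not at hlt
  have hne : i ≠ j := by rintro rfl; exact lt_irrefl _ hij
  have hp : 0 < φ (l j - l i) := hφ_pos _ (by rw [abs_lt]; constructor <;> linarith)
  have hlij := (hl j).sub (hl i)
  have hφt : Tendsto (fun t => φ (x t j - x t i)) atTop (𝓝 (φ (l j - l i))) :=
    (hφc.tendsto _).comp hlij
  set p := φ (l j - l i) / 2 with hpd
  have hp0 : 0 < p := by positivity
  have ev1 := hφt.eventually (lt_mem_nhds (show p < φ (l j - l i) by linarith))
  set d := (l j - l i) / 2 with hd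
  have hd0 : 0 < d := by simp only [hd]; linarith
  have ev2 := hlij.eventually (lt_mem_nhds (show d < l j - l i by linarith))
  obtain ⟨T, hT⟩ := eventually_atTop.1 ((ev1.and ev2).and (eventually_ge_atTop 0))
  have hT0 : 0 ≤ T := (hT T le_rfl).2
  have hwlow : ∀ t, T ≤ t → p - p * Real.exp (T - t) ≤ w t i j := by
    intro t ht
    have := aux_mono (fun s => (w s i j - p) * Real.exp s)
      (fun s => (φ (x s j - x s i) - p) * Real.exp s) T (fun s hs => by
        have h1 := ((hw i j hne s (hT0.trans hs)).sub_const p).mul (Real.hasDerivAt_exp s)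
        refine h1.congr_deriv ?_
        ring) (fun s hs => mul_nonneg (by linarith [(hT s hs).1.1]) (Real.exp_pos s).le)
        T t le_rfl ht
    have h3 := (hw01 T hT0 i j).1
    have h4 : -p * Real.exp T ≤ (w t i j - p) * Real.exp t := by
      refine le_trans ?_ this
      exact mul_le_mul_of_nonneg_right (by linarith) (Real.exp_pos T).le
    have h5 : Real.exp (T - t) * Real.exp t = Real.exp T := by
      rw [← Real.exp_add]; congr 1; ring
    have h6 : (-p * Real.exp (T - t)) * Real.exp t ≤ (w t i j - p) * Real.exp t := by
      rw [mul_assoc, h5]; exact h4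
    have := le_of_mul_le_mul_right h6 (Real.exp_pos t)
    linarith
  have hwlow2 : ∀ t, T + 1 ≤ t → p / 2 ≤ w t i j := by
    intro t ht
    have h1 := hwlow t (by linarith)
    have h2 : Real.exp (T - t) ≤ 1 / 2 := by
      have h3 : Real.exp (T - t) ≤ Real.exp (-1) := Real.exp_le_exp.2 (by linarith)
      have h4 := Real.exp_neg_one_lt_d9
      linarith
    nlinarith
  refine aux_contra N hN x c hc0 hcs hx' hb i j (T + 1) ((p / 2 * p / N) * d) (by linarith)
    (by positivity) ?_
  intro t ht
  have ht0 : 0 ≤ t := by linarith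
  obtain ⟨⟨h1, h2⟩, -⟩ := hT t (by linarith)
  have h3 := hwlow2 t ht
  have h4 := hclow t ht0 i j
  have h5 : p / 2 * p / N ≤ c t i j := by
    rw [div_le_iff₀ (by linarith)]
    have : p / 2 * p ≤ w t i j * φ (x t j - x t i) :=
      mul_le_mul h3 h1.le hp0.le (hw01 t ht0 i j).1
    linarith
  have h6 : d ≤ |x t j - x t i| := h2.le.trans (le_abs_self _)
  exact mul_le_mul h5 h6 hd0.le (hc0 t ht0 i j)
end

section
/- For the opinion dynamics with any nonnegative bounded weights, the function t ↦ max_i x_i(t) is nonincreasing and the function t ↦ min_i x_i(t) is nondecreasing on [0,∞); consequently every opinion remains in the interval [min_i x_i(0), max_i x_i(0)] for all t ≥ 0, and the opinion diameter D(t) = max_{i,j} |x_j(t) − x_i(t)| is nonincreasing. -/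
open Filter Topology MeasureTheory

theorem max_aux {N : ℕ} (y : ℝ → Fin N → ℝ) (y' : ℝ → Fin N → ℝ)
    (hy : ∀ i, ∀ t : ℝ, 0 ≤ t → HasDerivAt (fun s => y s i) (y' t i) t)
    (hmax : ∀ t : ℝ, 0 ≤ t → ∀ i, (∀ j, y t j ≤ y t i) → y' t i ≤ 0)
    (s t : ℝ) (hs : 0 ≤ s) (hst : s ≤ t) (M : ℝ) (hM : ∀ i, y s i ≤ M) (i : Fin N) :
    y t i ≤ M := by
  have hne : (Finset.univ : Finset (Fin N)).Nonempty := ⟨i, Finset.mem_univ i⟩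
  have hcont : ContinuousOn (fun u => Finset.univ.sup' hne (fun j => y u j)) (Set.Icc s t) := by
    apply ContinuousOn.finset_sup'_apply hne
    intro j _ u hu
    exact (hy j u (hs.trans hu.1)).continuousAt.continuousWithinAt
  have key := image_le_of_liminf_slope_right_le_deriv_boundary (a := s) (b := t)
    (f := fun u => Finset.univ.sup' hne (fun j => y u j)) (B := fun _ => M) (B' := fun _ => 0)
    hcont (Finset.sup'_le _ _ fun j _ => hM j) continuousOn_const
    (fun u _ => hasDerivWithinAt_const _ _ _) ?_
  · exact (Finset.le_sup' (fun j => y t j) (Finset.mem_univ i)).trans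
      (key (Set.right_mem_Icc.2 hst))
  · intro u hu r hr
    have hu0 : 0 ≤ u := hs.trans hu.1
    apply Eventually.frequently
    set F := Finset.univ.sup' hne (fun j => y u j) with hF
    have hle : ∀ j, y u j ≤ F := fun j => Finset.le_sup' (fun j => y u j) (Finset.mem_univ j)
    have hall : ∀ j, ∀ᶠ z in 𝓝[>] u, y z j < F + r * (z - u) := by
      intro j
      rcases (hle j).lt_or_eq with h | h
      · have h1 : ContinuousAt (fun z => F + r * (z - u) - y z j) u :=
          ContinuousAt.sub (by fun_prop) (hy j u hu0).continuousAt
        have h2 : ∀ᶠ z in 𝓝 u, 0 < F + r * (z - u) - y z j :=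
          h1.eventually (lt_mem_nhds (by simpa using h))
        filter_upwards [nhdsWithin_le_nhds h2] with z hz
        linarith
      · have hd : y' u j ≤ 0 := hmax u hu0 j (fun k => h ▸ hle k)
        have h1 := (hasDerivAt_iff_tendsto_slope.1 (hy j u hu0)).mono_left
          (nhdsWithin_mono u (fun z (hz : u < z) => ne_of_gt hz) : 𝓝[>] u ≤ _)
        filter_upwards [h1.eventually (gt_mem_nhds (lt_of_le_of_lt hd hr)),
          self_mem_nhdsWithin] with z hz hz'
        have hz' : u < z := hz'
        rw [slope_def_field, div_lt_iff₀ (sub_pos.2 hz')] at hz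
        linarith
    filter_upwards [eventually_all.2 hall, self_mem_nhdsWithin] with z hz hz'
    have hz' : u < z := hz'
    rw [slope_def_field, div_lt_iff₀ (sub_pos.2 hz')]
    have : Finset.univ.sup' hne (fun j => y z j) < F + r * (z - u) :=
      (Finset.sup'_lt_iff hne).2 fun j _ => hz j
    linarith

theorem stmt11
    (N : ℕ) (hN : 1 ≤ N)
    (x : ℝ → Fin N → ℝ) (w : ℝ → Fin N → Fin N → ℝ)
    (φ : ℝ → ℝ)
    (hφ_lip : ∃ L : NNReal, LipschitzWith L φ)
    (hφ_range : ∀ r : ℝ, φ r ∈ Set.Icc (0:ℝ) 1)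
    (hφ_even : ∀ r : ℝ, φ (-r) = φ r)
    (hw01 : ∀ t : ℝ, 0 ≤ t → ∀ i j, w t i j ∈ Set.Icc (0:ℝ) 1)
    (hwdiag : ∀ t : ℝ, 0 ≤ t → ∀ i, w t i i = 1)
    (hx : ∀ i, ∀ t : ℝ, 0 ≤ t →
      HasDerivAt (fun s => x s i)
        ((1 / ∑ j, w t i j) * ∑ j, w t i j * φ (x t j - x t i) * (x t j - x t i)) t)
    :
    AntitoneOn (fun t => ⨆ i, x t i) (Set.Ici 0) ∧
    MonotoneOn (fun t => ⨅ i, x t i) (Set.Ici 0) ∧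
    (∀ t : ℝ, 0 ≤ t → ∀ i, x t i ∈ Set.Icc (⨅ j, x 0 j) (⨆ j, x 0 j)) ∧
    AntitoneOn (fun t => ⨆ i, ⨆ j, |x t j - x t i|) (Set.Ici 0) := by
  have hk : ∀ t : ℝ, 0 ≤ t → ∀ i, 0 ≤ 1 / ∑ j, w t i j := fun t ht i =>
    one_div_nonneg.2 (Finset.sum_nonneg fun j _ => (hw01 t ht i j).1)
  have up : ∀ s t : ℝ, 0 ≤ s → s ≤ t → ∀ M : ℝ, (∀ i, x s i ≤ M) → ∀ i, x t i ≤ M := by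
    intro s t hs hst M hM i
    refine max_aux x _ hx ?_ s t hs hst M hM i
    intro t ht i hi
    refine mul_nonpos_of_nonneg_of_nonpos (hk t ht i) (Finset.sum_nonpos fun j _ => ?_)
    exact mul_nonpos_of_nonneg_of_nonpos (mul_nonneg (hw01 t ht i j).1 (hφ_range _).1)
      (sub_nonpos.2 (hi j))
  have dn : ∀ s t : ℝ, 0 ≤ s → s ≤ t → ∀ M : ℝ, (∀ i, M ≤ x s i) → ∀ i, M ≤ x t i := by
    intro s t hs hst M hM i
    have := max_aux (fun t i => - x t i) _ (fun i t ht => (hx i t ht).neg) ?_ s t hs hst (-M)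
      (fun i => neg_le_neg (hM i)) i
    · exact neg_le_neg_iff.1 this
    intro t ht i hi
    refine neg_nonpos.2 (mul_nonneg (hk t ht i) (Finset.sum_nonneg fun j _ => ?_))
    exact mul_nonneg (mul_nonneg (hw01 t ht i j).1 (hφ_range _).1)
      (sub_nonneg.2 (neg_le_neg_iff.1 (hi j)))
  haveI : Nonempty (Fin N) := ⟨⟨0, hN⟩⟩
  have bA : ∀ f : Fin N → ℝ, BddAbove (Set.range f) := fun f => (Set.finite_range f).bddAbove
  have bB : ∀ f : Fin N → ℝ, BddBelow (Set.range f) := fun f => (Set.finite_range f).bddBelow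
  refine ⟨?_, ?_, ?_, ?_⟩
  · intro s hs t _ hst
    exact ciSup_le (up s t hs hst _ fun i => le_ciSup (bA (x s)) i)
  · intro s hs t _ hst
    exact le_ciInf (dn s t hs hst _ fun i => ciInf_le (bB (x s)) i)
  · intro t ht i
    exact ⟨dn 0 t le_rfl ht _ (fun i => ciInf_le (bB (x 0)) i) i,
      up 0 t le_rfl ht _ (fun i => le_ciSup (bA (x 0)) i) i⟩
  · intro s hs t _ hst
    obtain ⟨a, ha⟩ := Finite.exists_max (x s)
    obtain ⟨b, hb⟩ := Finite.exists_min (x s)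
    have h1 : x s a - x s b ≤ ⨆ i, ⨆ j, |x s j - x s i| :=
      (le_abs_self _).trans ((le_ciSup (bA fun j => |x s j - x s b|) a).trans
        (le_ciSup (bA fun i => ⨆ j, |x s j - x s i|) b))
    refine ciSup_le fun i => ciSup_le fun j => le_trans ?_ h1
    have h2 := up s t hs hst _ ha
    have h3 := dn s t hs hst _ hb
    rw [abs_le]
    constructor <;> linarith [h2 i, h2 j, h3 i, h3 j]
end

section
/- (Barbalat's lemma, as used in the clustering proofs.) Let g : [0,∞) → ℝ be uniformly continuous and suppose the improper integral ∫₀^∞ g(t) dt converges (i.e. the function T ↦ ∫₀^T g(t) dt has a finite limit as T → ∞). Then g(t) → 0 as t → ∞. -/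
open Filter Topology MeasureTheory

theorem stmt12 (g : ℝ → ℝ)
    (hg : UniformContinuousOn g (Set.Ici 0))
    (hint : ∃ l : ℝ, Tendsto (fun T => ∫ t in (0:ℝ)..T, g t) atTop (𝓝 l)) :
    Tendsto g atTop (𝓝 0) := by
  obtain ⟨l, hl⟩ := hint
  have hii : ∀ a b : ℝ, 0 ≤ a → 0 ≤ b → IntervalIntegrable g volume a b := by
    intro a b ha hb
    apply ContinuousOn.intervalIntegrable
    apply hg.continuousOn.mono
    intro x hx
    rw [Set.mem_uIcc] at hx
    rw [Set.mem_Ici]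
    rcases hx with hx | hx <;> linarith [hx.1]
  rw [Metric.tendsto_nhds]
  intro ε hε
  rw [Metric.uniformContinuousOn_iff] at hg
  obtain ⟨δ, hδ, hgδ⟩ := hg (ε / 2) (by positivity)
  obtain ⟨h, hh, hhδ⟩ : ∃ h : ℝ, 0 < h ∧ h < δ := ⟨δ / 2, by positivity, by linarith⟩
  have h1 : Tendsto (fun T => (∫ t in (0:ℝ)..(T + h), g t) - ∫ t in (0:ℝ)..T, g t)
      atTop (𝓝 (l - l)) :=
    (hl.comp (tendsto_atTop_add_const_right atTop h tendsto_id)).sub hl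
  rw [sub_self, Metric.tendsto_nhds] at h1
  filter_upwards [h1 (ε / 2 * h) (by positivity), eventually_ge_atTop 0] with T hT hT0
  rw [intervalIntegral.integral_interval_sub_left (hii _ _ le_rfl (by linarith))
    (hii _ _ le_rfl hT0), Real.dist_eq, sub_zero] at hT
  have h2 : ‖∫ t in T..(T + h), (g t - g T)‖ ≤ ε / 2 * |T + h - T| := by
    apply intervalIntegral.norm_integral_le_of_norm_le_const
    intro x hx
    rw [Set.uIoc_of_le (by linarith)] at hx
    have := hgδ x (Set.mem_Ici.2 (by linarith [hx.1])) T hT0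
      (by rw [Real.dist_eq, abs_lt]; constructor <;> linarith [hx.1, hx.2])
    rw [Real.dist_eq] at this
    exact this.le
  rw [intervalIntegral.integral_sub (hii _ _ hT0 (by linarith)) intervalIntegrable_const,
    intervalIntegral.integral_const, add_sub_cancel_left, abs_of_pos hh, Real.norm_eq_abs,
    smul_eq_mul, abs_le] at h2
  rw [abs_lt] at hT
  rw [Real.dist_eq, sub_zero, abs_lt]
  constructor <;> nlinarith
end

section
/- Suppose there is a constant c_φ > 0 with φ(r) > c_φ for all r ∈ [−2,2], and suppose the weight dynamics are admissible with the additional property that there is a constant c_f > 0 such that f⁺(v)_{ij} > c_f for every matrix v with entries in [0,1] satisfying v_{ij} = 0 (i ≠ j). Then there exist ε > 0 and a finite time t* ≥ 0 such that w_{ij}(t) > ε for all pairs i ≠ j and all t ≥ t*; that is, all edge weights are eventually uniformly bounded away from zero. -/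
open Filter Topology MeasureTheory

theorem max_principle_aux {N : ℕ} (x d : ℝ → Fin N → ℝ) (c : ℝ)
    (h0 : ∀ i, x 0 i ≤ c)
    (hd : ∀ i, ∀ t : ℝ, 0 ≤ t → HasDerivAt (fun s => x s i) (d t i) t)
    (hmax : ∀ i, ∀ t : ℝ, 0 ≤ t → (∀ j, x t j ≤ x t i) → d t i ≤ 0) :
    ∀ T : ℝ, 0 ≤ T → ∀ i, x T i ≤ c := by
  intro T hT i₀
  have key : ∀ e : ℝ, 0 < e → x T i₀ - e * T ≤ c := by
    intro e he
    have hy : ∀ i, ∀ t : ℝ, 0 ≤ t → HasDerivAt (fun s => x s i - e * s) (d t i - e) t := by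
      intro i t ht
      have := (hd i t ht).sub ((hasDerivAt_id t).const_mul e)
      rw [mul_one] at this
      exact this
    have hex : ∀ i, ∃ t ∈ Set.Icc (0:ℝ) T, ∀ s ∈ Set.Icc (0:ℝ) T,
        x s i - e * s ≤ x t i - e * t := by
      intro i
      have hc : ContinuousOn (fun s => x s i - e * s) (Set.Icc 0 T) :=
        fun t ht => (hy i t ht.1).continuousAt.continuousWithinAt
      obtain ⟨t, ht, hm⟩ := isCompact_Icc.exists_isMaxOn ⟨0, le_refl _, hT⟩ hc
      exact ⟨t, ht, fun s hs => hm hs⟩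
    choose τ hτ hτm using hex
    have : Nonempty (Fin N) := ⟨i₀⟩
    obtain ⟨i, hi⟩ := Finite.exists_max (fun i => x (τ i) i - e * τ i)
    have hall : ∀ j, ∀ s ∈ Set.Icc (0:ℝ) T, x s j - e * s ≤ x (τ i) i - e * τ i :=
      fun j s hs => (hτm j s hs).trans (hi j)
    have h1 := hall i₀ T ⟨hT, le_refl _⟩
    rcases (hτ i).1.eq_or_lt with h | h
    · rw [← h] at h1
      have := h0 i
      linarith
    · exfalso
      have hdn : d (τ i) i ≤ 0 := by
        apply hmax i _ (hτ i).1
        intro j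
        have := hall j (τ i) (hτ i)
        linarith
      have hs := (hasDerivWithinAt_iff_tendsto_slope' (s := Set.Iio (τ i)) (by simp)).1
        ((hy i _ (hτ i).1).hasDerivWithinAt)
      have hge : 0 ≤ d (τ i) i - e := by
        refine ge_of_tendsto hs ?_
        filter_upwards [Ioo_mem_nhdsLT h] with s hs
        have := hall i s ⟨hs.1.le, hs.2.le.trans (hτ i).2⟩
        rw [slope_def_field]
        exact div_nonneg_of_nonpos (by linarith) (by linarith [hs.2])
      linarith
  by_contra hcon
  push Not at hcon
  have h2 := key ((x T i₀ - c) / (2 * (T + 1))) (div_pos (by linarith) (by linarith))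
  have h3 : (x T i₀ - c) / (2 * (T + 1)) * T ≤ (x T i₀ - c) / 2 := by
    rw [div_mul_eq_mul_div, div_le_div_iff₀ (by linarith) (by norm_num)]
    nlinarith
  linarith

theorem relax_aux (u d : ℝ → ℝ) (a b : ℝ) (ha : 0 < a) (hb : 0 < b)
    (h0 : 0 ≤ u 0) (hu : ∀ t : ℝ, 0 ≤ t → HasDerivAt u (d t) t)
    (hd : ∀ t : ℝ, 0 ≤ t → a - b * u t ≤ d t) :
    ∀ t : ℝ, 1 ≤ t → a / b * (1 - Real.exp (-b)) ≤ u t := by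
  intro t ht
  have hg : ∀ s : ℝ, 0 ≤ s → HasDerivAt (fun s => (u s - a / b) * Real.exp (b * s))
      (d s * Real.exp (b * s) + (u s - a / b) * (Real.exp (b * s) * b)) s := by
    intro s hs
    have h1 := ((hasDerivAt_id s).const_mul b).exp
    have := ((hu s hs).sub_const (a / b)).mul h1
    rw [mul_one] at this
    exact this
  have hmono : MonotoneOn (fun s => (u s - a / b) * Real.exp (b * s)) (Set.Ici 0) := by
    apply monotoneOn_of_hasDerivWithinAt_nonneg (convex_Ici 0)
      (fun s hs => (hg s hs).continuousAt.continuousWithinAt)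
      (fun s hs => (hg s (interior_subset hs)).hasDerivWithinAt)
    intro s hs
    have := hd s (interior_subset hs)
    have e1 : d s * Real.exp (b * s) + (u s - a / b) * (Real.exp (b * s) * b)
      = (d s - (a - b * u s)) * Real.exp (b * s) := by field_simp; ring
    rw [e1]
    exact mul_nonneg (by linarith) (Real.exp_pos _).le
  have h1 := hmono (Set.mem_Ici.2 le_rfl) (Set.mem_Ici.2 (by linarith : (0:ℝ) ≤ t)) (by linarith)
  simp only [mul_zero, Real.exp_zero, mul_one] at h1
  have hab : 0 < a / b := div_pos ha hb
  have h2 : - (a / b) * Real.exp (-(b * t)) ≤ u t - a / b := by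
    have h3 : (u t - a / b) * Real.exp (b * t) * Real.exp (-(b * t)) = u t - a / b := by
      rw [mul_assoc, ← Real.exp_add]; simp
    rw [← h3]
    exact mul_le_mul_of_nonneg_right (by linarith) (Real.exp_pos _).le
  have h4 : Real.exp (-(b * t)) ≤ Real.exp (-b) := Real.exp_le_exp.2 (by nlinarith)
  nlinarith

theorem stmt13
    (N : ℕ) (hN : 1 ≤ N)
    (x : ℝ → Fin N → ℝ) (w : ℝ → Fin N → Fin N → ℝ)
    (φ : ℝ → ℝ)
    (hφ_lip : ∃ L : NNReal, LipschitzWith L φ)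
    (hφ_range : ∀ r : ℝ, φ r ∈ Set.Icc (0:ℝ) 1)
    (hφ_even : ∀ r : ℝ, φ (-r) = φ r)
    (hw01 : ∀ t : ℝ, 0 ≤ t → ∀ i j, w t i j ∈ Set.Icc (0:ℝ) 1)
    (hwdiag : ∀ t : ℝ, 0 ≤ t → ∀ i, w t i i = 1)
    (hx0 : ∀ i, x 0 i ∈ Set.Icc (-1:ℝ) 1)
    (hx : ∀ i, ∀ t : ℝ, 0 ≤ t →
      HasDerivAt (fun s => x s i)
        ((1 / ∑ j, w t i j) * ∑ j, w t i j * φ (x t j - x t i) * (x t j - x t i)) t)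
    (fp fm : (Fin N → Fin N → ℝ) → (Fin N → Fin N → ℝ))
    (hfp_lip : ∃ L : NNReal, LipschitzOnWith L fp (cube N))
    (hfm_lip : ∃ L : NNReal, LipschitzOnWith L fm (cube N))
    (hf_nonneg : ∀ v ∈ cube N, ∀ i j, i ≠ j → 0 ≤ fp v i j ∧ 0 ≤ fm v i j)
    (hfp_one : ∀ v ∈ cube N, ∀ i j, i ≠ j → v i j = 1 → fp v i j = 0)
    (hfm_zero : ∀ v ∈ cube N, ∀ i j, i ≠ j → v i j = 0 → fm v i j = 0)
    (hw : ∀ i j, i ≠ j → ∀ t : ℝ, 0 ≤ t →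
      HasDerivAt (fun s => w s i j)
        (φ (x t j - x t i) * fp (w t) i j - (1 - φ (x t j - x t i)) * fm (w t) i j) t)
    (hwdiag' : ∀ i, ∀ t : ℝ, 0 ≤ t → HasDerivAt (fun s => w s i i) (0:ℝ) t)
    (c_φ : ℝ) (hc_φ : 0 < c_φ)
    (hφc : ∀ r ∈ Set.Icc (-2:ℝ) 2, c_φ < φ r)
    (c_f : ℝ) (hc_f : 0 < c_f)
    (hfp_pos : ∀ v ∈ cube N, ∀ i j, i ≠ j → v i j = 0 → c_f < fp v i j) :
    ∃ ε : ℝ, 0 < ε ∧ ∃ tstar : ℝ, 0 ≤ tstar ∧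
      ∀ i j, i ≠ j → ∀ t : ℝ, tstar ≤ t → ε < w t i j := by
  have hk : ∀ t : ℝ, 0 ≤ t → ∀ i, 0 ≤ 1 / ∑ j, w t i j := fun t ht i =>
    one_div_nonneg.2 (Finset.sum_nonneg fun j _ => (hw01 t ht i j).1)
  have hup : ∀ T : ℝ, 0 ≤ T → ∀ i, x T i ≤ 1 := by
    refine max_principle_aux x _ 1 (fun i => (hx0 i).2) hx ?_
    intro i t ht hm
    refine mul_nonpos_of_nonneg_of_nonpos (hk t ht i) (Finset.sum_nonpos fun j _ => ?_)
    exact mul_nonpos_of_nonneg_of_nonpos (mul_nonneg (hw01 t ht i j).1 (hφ_range _).1)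
      (by linarith [hm j])
  have hlo : ∀ T : ℝ, 0 ≤ T → ∀ i, -x T i ≤ 1 := by
    refine max_principle_aux (fun t i => -x t i) _ 1 (fun i => by linarith [(hx0 i).1])
      (fun i t ht => (hx i t ht).neg) ?_
    intro i t ht hm
    refine neg_nonpos.2 (mul_nonneg (hk t ht i) (Finset.sum_nonneg fun j _ => ?_))
    exact mul_nonneg (mul_nonneg (hw01 t ht i j).1 (hφ_range _).1)
      (by have := hm j; linarith)
  obtain ⟨Lp, hLp⟩ := hfp_lip
  obtain ⟨Lm, hLm⟩ := hfm_lip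
  have hcube : ∀ t : ℝ, 0 ≤ t → w t ∈ cube N := fun t ht i j => hw01 t ht i j
  have hest : ∀ (f : (Fin N → Fin N → ℝ) → (Fin N → Fin N → ℝ)) (L : NNReal),
      LipschitzOnWith L f (cube N) → ∀ v ∈ cube N, ∀ i j, i ≠ j → ∃ v' ∈ cube N,
        v' i j = 0 ∧ |f v i j - f v' i j| ≤ L * v i j := by
    intro f L hL v hv i j hij
    refine ⟨fun k l => if k = i ∧ l = j then 0 else v k l, ?_, by simp, ?_⟩
    · intro k l
      dsimp only
      split_ifs
      · simp
      · exact hv k l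
    · set v' : Fin N → Fin N → ℝ := fun k l => if k = i ∧ l = j then 0 else v k l with hv'
      have hv'c : v' ∈ cube N := by
        intro k l
        simp only [hv']
        split_ifs
        · simp
        · exact hv k l
      have h1 := hL.dist_le_mul v hv v' hv'c
      have h2 : dist v v' ≤ v i j := by
        refine (dist_pi_le_iff (hv i j).1).2 fun k => (dist_pi_le_iff (hv i j).1).2 fun l => ?_
        simp only [hv']
        split_ifs with h
        · rw [h.1, h.2, Real.dist_eq, sub_zero, abs_of_nonneg (hv i j).1]
        · rw [dist_self]; exact (hv i j).1
      have h3 : |f v i j - f v' i j| ≤ dist (f v) (f v') := by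
        rw [← Real.dist_eq]
        exact (dist_le_pi_dist (f v i) (f v' i) j).trans (dist_le_pi_dist (f v) (f v') i)
      exact h3.trans (h1.trans (mul_le_mul_of_nonneg_left h2 L.2))
  have ha : 0 < c_φ * c_f := mul_pos hc_φ hc_f
  have hb : 0 < c_φ * Lp + Lm + 1 := by
    have := mul_nonneg hc_φ.le Lp.coe_nonneg
    have := Lm.coe_nonneg
    linarith
  set a := c_φ * c_f with had
  set b := c_φ * Lp + Lm + 1 with hbd
  have hpos : 0 < a / b * (1 - Real.exp (-b)) :=
    mul_pos (div_pos ha hb) (by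
      have : Real.exp (-b) < 1 := Real.exp_lt_one_iff.2 (by linarith)
      linarith)
  refine ⟨a / b * (1 - Real.exp (-b)) / 2, by linarith, 1, zero_le_one, ?_⟩
  intro i j hij t ht
  have := relax_aux (fun s => w s i j) _ a b ha hb (hw01 0 le_rfl i j).1 (hw i j hij) ?_ t ht
  · linarith
  intro s hs
  have hφ1 : c_φ < φ (x s j - x s i) := by
    apply hφc
    have := hup s hs i
    have := hup s hs j
    have := hlo s hs i
    have := hlo s hs j
    constructor <;> linarith
  obtain ⟨v, hv, hv0, hvp⟩ := hest fp Lp hLp (w s) (hcube s hs) i j hij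
  obtain ⟨v2, hv2, hv20, hvm⟩ := hest fm Lm hLm (w s) (hcube s hs) i j hij
  have p1 := hfp_pos v hv i j hij hv0
  have m1 := hfm_zero v2 hv2 i j hij hv20
  obtain ⟨np, nm⟩ := hf_nonneg (w s) (hcube s hs) i j hij
  have p2 := (abs_le.1 hvp).1
  have m2 := (abs_le.1 hvm).2
  have hw0 := (hw01 s hs i j).1
  have q1 : c_φ * (c_f - Lp * w s i j) ≤ φ (x s j - x s i) * fp (w s) i j :=
    (mul_le_mul_of_nonneg_left (by linarith) hc_φ.le).trans
      (mul_le_mul_of_nonneg_right hφ1.le np)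
  have q2 : (1 - φ (x s j - x s i)) * fm (w s) i j ≤ Lm * w s i j := by
    have : (1 - φ (x s j - x s i)) * fm (w s) i j ≤ 1 * fm (w s) i j :=
      mul_le_mul_of_nonneg_right (by linarith [(hφ_range (x s j - x s i)).1]) nm
    linarith
  have q3 : a - b * w s i j = c_φ * (c_f - Lp * w s i j) - Lm * w s i j - w s i j := by
    rw [had, hbd]; ring
  show a - b * w s i j ≤ _
  rw [q3]
  linarith
end

section
/- Under memory weight dynamics, if there is a constant c > 0 with φ(r) ≥ c for all r ∈ [−2,2], then for every pair i ≠ j and every t ≥ 0 the edge weight satisfies w_{ij}(t) ≥ e^{−t}·w_{ij}(0) + c·(1 − e^{−t}); in particular w_{ij}(t) ≥ c·(1 − e^{−t}). -/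
open Filter Topology MeasureTheory

theorem stmt14
    (N : ℕ) (hN : 1 ≤ N)
    (x : ℝ → Fin N → ℝ) (w : ℝ → Fin N → Fin N → ℝ)
    (φ : ℝ → ℝ)
    (hφ_lip : ∃ L : NNReal, LipschitzWith L φ)
    (hφ_range : ∀ r : ℝ, φ r ∈ Set.Icc (0:ℝ) 1)
    (hφ_even : ∀ r : ℝ, φ (-r) = φ r)
    (hw01 : ∀ t : ℝ, 0 ≤ t → ∀ i j, w t i j ∈ Set.Icc (0:ℝ) 1)
    (hwdiag : ∀ t : ℝ, 0 ≤ t → ∀ i, w t i i = 1)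
    (hxcont : ∀ i, Continuous (fun t => x t i))
    (hxrange : ∀ t : ℝ, 0 ≤ t → ∀ i, x t i ∈ Set.Icc (-1:ℝ) 1)
    (hw : ∀ i j, i ≠ j → ∀ t : ℝ, 0 ≤ t →
      HasDerivAt (fun s => w s i j) (φ (x t j - x t i) - w t i j) t)
    (c : ℝ) (hc : 0 < c)
    (hφc : ∀ r ∈ Set.Icc (-2:ℝ) 2, c ≤ φ r) :
    ∀ i j, i ≠ j → ∀ t : ℝ, 0 ≤ t →
      Real.exp (-t) * w 0 i j + c * (1 - Real.exp (-t)) ≤ w t i j ∧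
      c * (1 - Real.exp (-t)) ≤ w t i j := by
  intro i j hij t ht
  have hd : ∀ s : ℝ, 0 ≤ s → HasDerivAt (fun s => Real.exp s * (w s i j - c))
      (Real.exp s * (w s i j - c) + Real.exp s * (φ (x s j - x s i) - w s i j)) s :=
    fun s hs => (Real.hasDerivAt_exp s).mul ((hw i j hij s hs).sub_const c)
  have hm : MonotoneOn (fun s => Real.exp s * (w s i j - c)) (Set.Ici 0) := by
    apply monotoneOn_of_deriv_nonneg (convex_Ici 0)
    · exact fun s hs => (hd s hs).continuousAt.continuousWithinAt
    · intro s hs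
      exact (hd s (interior_subset hs)).differentiableAt.differentiableWithinAt
    · intro s hs
      have hs0 : (0:ℝ) ≤ s := interior_subset hs
      rw [(hd s hs0).deriv]
      have h1 := hxrange s hs0 i
      have h2 := hxrange s hs0 j
      have h3 := hφc (x s j - x s i) ⟨by linarith [h1.2, h2.1], by linarith [h1.1, h2.2]⟩
      have h4 := mul_nonneg (Real.exp_pos s).le (sub_nonneg.2 h3)
      linarith
  have h := hm (Set.mem_Ici.2 le_rfl) (Set.mem_Ici.2 ht) ht
  simp only [Real.exp_zero, one_mul] at h
  have h5 := mul_le_mul_of_nonneg_left h (Real.exp_pos (-t)).le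
  rw [← mul_assoc, ← Real.exp_add, neg_add_cancel, Real.exp_zero, one_mul] at h5
  have h6 := mul_nonneg (Real.exp_pos (-t)).le (hw01 0 le_rfl i j).1
  constructor <;> linarith
end
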